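/- Let H be a separable real Hilbert space and let T : H → H be a positive self-adjoint compact operator whose eigenvalue-counting function satisfies M_T(γ) = κ₁ γ^{-β₁} + κ₂ γ^{-β₂} + o(γ^{-β₂}) as γ → 0, where κ₁ > 0, κ₂ ∈ ℝ, β₁, β₂ > 0, and either β₁/2 < β₂ < β₁, or β₁ = β₂ and κ₂ = 0. Then the entropy of T satisfies H(ε;T) = (κ₁/(β₁ ln 2)) ε^{-β₁} + (κ₂/(β₂ ln 2)) ε^{-β₂} + o(ε^{-β₂}) as ε → 0. -/

import Mathlib

open MeasureTheory Filter Asymptotics Topology TopologicalSpace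
open scoped BigOperators ENNReal NNReal

noncomputable section

/-- The `ε`-covering number of a set `K` in a (pseudo)metric space: the minimal cardinality of a
finite set of points such that every point of `K` lies within distance `ε` of one of them. -/
def coveringNumber {X : Type*} [PseudoMetricSpace X] (ε : ℝ) (K : Set X) : ℕ :=
  sInf {n : ℕ | ∃ s : Finset X, s.card = n ∧ ∀ x ∈ K, ∃ y ∈ s, dist x y ≤ ε}

/-- The metric entropy `H(ε; K) = log₂ N(ε; K)`. -/
def metricEntropy {X : Type*} [PseudoMetricSpace X] (ε : ℝ) (K : Set X) : ℝ :=
  Real.logb 2 (coveringNumber ε K)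

/-- The entropy of a continuous linear operator: the metric entropy of the closure of the image
of the closed unit ball. -/
def opEntropy {H : Type*} [NormedAddCommGroup H] [InnerProductSpace ℝ H]
    (ε : ℝ) (T : H →L[ℝ] H) : ℝ :=
  metricEntropy ε (closure (T '' Metric.closedBall 0 1))

/-- If every set of a finite family has probability at least `p`, some point lies in at least a
fraction `p` of the family. -/
lemma exists_mem_many {X ι : Type*} [MeasurableSpace X] (P : Measure X) [IsProbabilityMeasure P]
    (U : Finset ι) (A : ι → Set X) (hA : ∀ i, MeasurableSet (A i)) {p : ℝ}
    (hp : ∀ i ∈ U, p ≤ P.real (A i)) :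
    ∃ y, p * U.card ≤ ∑ i ∈ U, (A i).indicator (fun _ => (1 : ℝ)) y := by
  have hinteg : ∀ i ∈ U, Integrable ((A i).indicator (fun _ => (1 : ℝ))) P := fun i _ =>
    (integrable_const (1 : ℝ)).indicator (hA i)
  obtain ⟨y, hy⟩ := exists_integral_le (μ := P)
    (f := fun y => ∑ i ∈ U, (A i).indicator (fun _ => (1 : ℝ)) y) (integrable_finsetSum U hinteg)
  refine ⟨y, le_trans ?_ hy⟩
  rw [integral_finsetSum U hinteg]
  calc p * U.card = ∑ i ∈ U, p := by rw [Finset.sum_const, nsmul_eq_mul, mul_comm]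
    _ ≤ _ := Finset.sum_le_sum fun i hi => by
      rw [integral_indicator_const _ (hA i)]
      simpa using hp i hi

open Classical in
/-- Greedy hitting sets: `n` points can be chosen so that the sets of the family containing none
of them are at most a fraction `(1 - p) ^ n` of the family. -/
lemma exists_greedy_hitting {X ι : Type*} [MeasurableSpace X] (P : Measure X)
    [IsProbabilityMeasure P] (U : Finset ι) (A : ι → Set X) (hA : ∀ i, MeasurableSet (A i))
    {p : ℝ} (hp1 : p ≤ 1) (hp : ∀ i ∈ U, p ≤ P.real (A i)) (n : ℕ) :
    ∃ s : Finset X, s.card ≤ n ∧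
      ((U.filter fun i => ∀ y ∈ s, y ∉ A i).card : ℝ) ≤ (1 - p) ^ n * U.card := by
  induction n with
  | zero => exact ⟨∅, by simp, by simp⟩
  | succ n ih =>
    obtain ⟨s, hs, hU⟩ := ih
    set W := U.filter fun i => ∀ y ∈ s, y ∉ A i with hW
    obtain ⟨y, hy⟩ := exists_mem_many P W A hA (fun i hi => hp i (Finset.mem_filter.1 hi).1)
    refine ⟨insert y s, (Finset.card_insert_le _ _).trans (by omega), ?_⟩
    have h1 : (U.filter fun i => ∀ z ∈ insert y s, z ∉ A i) = W.filter fun i => y ∉ A i := by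
      ext i; simp only [hW, Finset.mem_filter, Finset.forall_mem_insert]; tauto
    have h2 : ∑ i ∈ W, (A i).indicator (fun _ => (1 : ℝ)) y = (W.filter fun i => y ∈ A i).card := by
      rw [Finset.card_filter]; push_cast
      exact Finset.sum_congr rfl fun i _ => by simp [Set.indicator_apply]
    have h3 := Finset.card_filter_add_card_filter_not (s := W) (fun i => y ∈ A i)
    have h3' : ((W.filter fun i => y ∈ A i).card : ℝ) + (W.filter fun i => y ∉ A i).card
        = W.card := by exact_mod_cast h3
    rw [h1]
    calc ((W.filter fun i => y ∉ A i).card : ℝ) ≤ (1 - p) * W.card := by linarith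
      _ ≤ (1 - p) * ((1 - p) ^ n * U.card) := by
        exact mul_le_mul_of_nonneg_left hU (by linarith)
      _ = _ := by ring

/-- A family of `#U` sets, each of probability at least `p`, has a hitting set of size at most
`(log #U + 1) / p`. -/
lemma exists_hitting {X ι : Type*} [MeasurableSpace X] (P : Measure X)
    [IsProbabilityMeasure P] (U : Finset ι) (A : ι → Set X) (hA : ∀ i, MeasurableSet (A i))
    {p : ℝ} (hp0 : 0 < p) (hp1 : p ≤ 1) (hp : ∀ i ∈ U, p ≤ P.real (A i)) :
    ∃ s : Finset X, (s.card : ℝ) ≤ (Real.log U.card + 1) / p ∧ ∀ i ∈ U, ∃ y ∈ s, y ∈ A i := by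
  classical
  have hlog : 0 ≤ Real.log U.card := Real.log_natCast_nonneg _
  obtain ⟨s, hs, hU⟩ := exists_greedy_hitting P U A hA hp1 hp (⌊Real.log U.card / p⌋₊ + 1)
  refine ⟨s, ?_, ?_⟩
  · have h1 : ((⌊Real.log U.card / p⌋₊ : ℕ) : ℝ) ≤ Real.log U.card / p :=
      Nat.floor_le (by positivity)
    have h2 : (1 : ℝ) ≤ 1 / p := by rw [le_div_iff₀ hp0]; linarith
    have h3 : (s.card : ℝ) ≤ (⌊Real.log U.card / p⌋₊ : ℝ) + 1 := by exact_mod_cast hs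
    rw [add_div]; linarith
  · rcases U.eq_empty_or_nonempty with rfl | hne
    · simp
    have hUpos : (0 : ℝ) < U.card := by exact_mod_cast hne.card_pos
    have hlt : (1 - p) ^ (⌊Real.log U.card / p⌋₊ + 1) * (U.card : ℝ) < 1 := by
      have h1 : (1 - p) ^ (⌊Real.log U.card / p⌋₊ + 1)
          ≤ Real.exp (-p) ^ (⌊Real.log U.card / p⌋₊ + 1) :=
        pow_le_pow_left₀ (by linarith) (Real.one_sub_le_exp_neg p) _
      rw [← Real.exp_nat_mul] at h1
      have h2 : Real.log U.card / p < (⌊Real.log U.card / p⌋₊ + 1 : ℕ) := by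
        push_cast; exact Nat.lt_floor_add_one _
      rw [div_lt_iff₀ hp0] at h2
      calc _ ≤ Real.exp (((⌊Real.log U.card / p⌋₊ + 1 : ℕ) : ℝ) * -p) * (U.card : ℝ) := by gcongr
        _ < Real.exp (-Real.log U.card) * U.card := by
          gcongr; linarith
        _ = 1 := by rw [Real.exp_neg, Real.exp_log hUpos, inv_mul_cancel₀ hUpos.ne']
    have hz : (U.filter fun i => ∀ y ∈ s, y ∉ A i).card = 0 := by
      have : ((U.filter fun i => ∀ y ∈ s, y ∉ A i).card : ℝ) < 1 := lt_of_le_of_lt hU hlt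
      exact Nat.lt_one_iff.1 (by exact_mod_cast this)
    intro i hi
    by_contra! hcon
    rw [Finset.card_eq_zero] at hz
    exact Finset.notMem_empty i (hz ▸ Finset.mem_filter.2 ⟨hi, hcon⟩)

section BallCovering

variable {V : Type*} [NormedAddCommGroup V] [InnerProductSpace ℝ V]

/-- Shrinking by the factor `1 / k` in the direction of `x`. -/
def squeeze (x : V) (k : ℝ) : V →ₗ[ℝ] V :=
  LinearMap.transvection ((-(1 - 1 / k) / ‖x‖ ^ 2) • (innerₛₗ ℝ x)) x

lemma squeeze_apply (x z : V) (k : ℝ) :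
    squeeze x k z = z + (-(1 - 1 / k) / ‖x‖ ^ 2 * inner ℝ x z) • x := by
  simp [squeeze, LinearMap.transvection.apply]

lemma inner_squeeze (x z : V) (k : ℝ) : inner ℝ x (squeeze x k z) = inner ℝ x z / k := by
  rcases eq_or_ne x 0 with rfl | hx
  · simp
  have : ‖x‖ ≠ 0 := norm_ne_zero_iff.2 hx
  rw [squeeze_apply, inner_add_right, inner_smul_right, real_inner_self_eq_norm_sq]
  field_simp
  ring

lemma norm_squeeze_le (x z : V) {k : ℝ} (hk : 1 ≤ k) : ‖squeeze x k z‖ ≤ ‖z‖ := by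
  rcases eq_or_ne x 0 with rfl | hx
  · simp [squeeze_apply]
  have hx' : 0 < ‖x‖ := norm_pos_iff.2 hx
  have hk1 : 1 / k ≤ 1 := by rw [div_le_one (by linarith)]; exact hk
  have hk0 : 0 ≤ 1 / k := by positivity
  refine le_of_sq_le_sq ?_ (norm_nonneg _)
  rw [squeeze_apply, norm_add_sq_real, inner_smul_right, norm_smul, mul_pow, Real.norm_eq_abs,
    sq_abs, real_inner_comm x z]
  have : ‖z‖ ^ 2 + 2 * (-(1 - 1 / k) / ‖x‖ ^ 2 * inner ℝ x z * inner ℝ x z)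
      + (-(1 - 1 / k) / ‖x‖ ^ 2 * inner ℝ x z) ^ 2 * ‖x‖ ^ 2
      = ‖z‖ ^ 2 - (inner ℝ x z / ‖x‖) ^ 2 * ((1 - 1 / k) * (1 + 1 / k)) := by
    field_simp; ring
  rw [this]
  have : 0 ≤ (inner ℝ x z / ‖x‖) ^ 2 * ((1 - 1 / k) * (1 + 1 / k)) :=
    mul_nonneg (sq_nonneg _) (mul_nonneg (by linarith) (by linarith))
  linarith

lemma inv_le_det_squeeze [FiniteDimensional ℝ V] (x : V) {k : ℝ} (hk : 1 ≤ k) :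
    1 / k ≤ LinearMap.det (squeeze x k) := by
  have hk1 : 1 / k ≤ 1 := by rw [div_le_one (by linarith)]; exact hk
  rw [squeeze, LinearMap.transvection.det]
  rcases eq_or_ne x 0 with rfl | hx
  · simpa using hk1
  have : ‖x‖ ≠ 0 := norm_ne_zero_iff.2 hx
  simp only [LinearMap.smul_apply, innerₛₗ_apply_apply, real_inner_self_eq_norm_sq, smul_eq_mul]
  field_simp
  linarith

/-- For `‖x‖ ≤ r`, a point `(1 - 1/r²) x + w` with `w` short and nearly orthogonal to `x` is
within distance about `1` of `x` and in the ball of radius about `√(r² - 1)`. -/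
lemma shifted_mem {r k : ℝ} (hr : 1 ≤ r) (hk : 1 ≤ k) {x w : V} (hx : ‖x‖ ≤ r)
    (hw : ‖w‖ ^ 2 ≤ 1 - 1 / r ^ 2) (hxw : |inner ℝ x w| ≤ r * √(1 - 1 / r ^ 2) / k) :
    ‖(1 - 1 / r ^ 2) • x + w‖ ^ 2 ≤ (1 - 1 / r ^ 2) * r ^ 2 * (1 + 2 / k) ∧
      ‖(1 - 1 / r ^ 2) • x + w - x‖ ^ 2 ≤ 1 + 2 / k := by
  have hr0 : 0 < r := by linarith
  have hrr : 1 / r ^ 2 ≤ 1 := by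
    rw [div_le_one (by positivity)]; nlinarith
  have hrr0 : 0 < 1 / r ^ 2 := by positivity
  have hxx : ‖x‖ ^ 2 ≤ r ^ 2 := by gcongr
  set u := 1 - 1 / r ^ 2 with hu
  have hu0 : 0 ≤ u := by linarith
  have hur : u * r ^ 2 = r ^ 2 - 1 := by rw [hu]; field_simp
  have hsq : √u ^ 2 = u := Real.sq_sqrt hu0
  have hs0 := Real.sqrt_nonneg u
  have hs1 : √u ≤ 1 := by rw [Real.sqrt_le_one]; linarith
  have hin := abs_le.1 hxw
  have hsr : √u ≤ r := by linarith
  constructor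
  · rw [norm_add_sq_real, norm_smul, mul_pow, Real.norm_eq_abs, sq_abs, real_inner_smul_left]
    have h1 : u ^ 2 * ‖x‖ ^ 2 ≤ u ^ 2 * r ^ 2 := by gcongr
    have h2 : u * inner ℝ x w ≤ u * (r * √u / k) := by gcongr; exact hin.2
    have h3 : u * (r * √u / k) ≤ u * (r * r / k) := by gcongr
    have h4 : u ^ 2 * r ^ 2 + u = u * r ^ 2 := by linear_combination u * hur
    calc _ ≤ u ^ 2 * r ^ 2 + 2 * (u * (r * r / k)) + u := by linarith
      _ = _ := by rw [show u ^ 2 * r ^ 2 + 2 * (u * (r * r / k)) + u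
          = (u ^ 2 * r ^ 2 + u) + 2 * (u * (r * r / k)) by ring, h4]; ring
  · have e : u • x + w - x = (-(1 / r ^ 2)) • x + w := by
      rw [hu]; module
    rw [e, norm_add_sq_real, norm_smul, mul_pow, Real.norm_eq_abs, sq_abs, real_inner_smul_left]
    have h1 : (-(1 / r ^ 2)) ^ 2 * ‖x‖ ^ 2 ≤ 1 / r ^ 2 := by
      calc _ ≤ (-(1 / r ^ 2)) ^ 2 * r ^ 2 := by gcongr
        _ = _ := by field_simp
    have h2 : -(1 / r ^ 2) * inner ℝ x w ≤ 1 / k := by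
      calc _ = (1 / r ^ 2) * (-inner ℝ x w) := by ring
        _ ≤ (1 / r ^ 2) * (r * r / k) := by
          gcongr
          calc _ ≤ r * √u / k := by linarith [hin.1]
            _ ≤ _ := by gcongr
        _ = 1 / k := by field_simp
    have : 2 / k = 2 * (1 / k) := by ring
    linarith

variable [FiniteDimensional ℝ V] [MeasurableSpace V] [BorelSpace V]

lemma volume_shell_inter_ball {r : ℝ} {k : ℕ} (hr : 1 < r) (hk : 1 ≤ k)
    (hdim : Module.finrank ℝ V ≤ k) {x : V} (hx : ‖x‖ ≤ r) :
    (k * Real.exp 1 * r ^ Module.finrank ℝ V)⁻¹ *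
        volume.real (Metric.closedBall (0 : V) (√(1 - 1 / r ^ 2) * r * √(1 + 2 / k)))
      ≤ volume.real (Metric.closedBall (0 : V) (√(1 - 1 / r ^ 2) * r * √(1 + 2 / k)) ∩
          Metric.closedBall x √(1 + 2 / k)) := by
  have hk' : (1 : ℝ) ≤ k := by exact_mod_cast hk
  have hr0 : 0 < r := by linarith
  have hrr : 1 / r ^ 2 < 1 := by
    rw [div_lt_one (by positivity)]; nlinarith
  set m := Module.finrank ℝ V with hm
  set h := √(1 - 1 / r ^ 2) with hh
  have hh0 : 0 < h := Real.sqrt_pos.2 (by linarith)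
  have hhsq : h ^ 2 = 1 - 1 / r ^ 2 := Real.sq_sqrt (by linarith)
  set s := √(1 + 2 / (k : ℝ)) with hs
  have hs0 : 0 < s := Real.sqrt_pos.2 (by positivity)
  have hssq : s ^ 2 = 1 + 2 / k := Real.sq_sqrt (by positivity)
  have hsm : s ^ m ≤ Real.exp 1 := by
    have h1 : s ≤ Real.exp (1 / k) := by
      rw [hs, Real.sqrt_le_left (Real.exp_pos _).le, ← Real.exp_nat_mul]
      have := Real.add_one_le_exp (((2 : ℕ) : ℝ) * (1 / k))
      calc _ = ((2 : ℕ) : ℝ) * (1 / k) + 1 := by push_cast; ring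
        _ ≤ _ := this
    calc s ^ m ≤ Real.exp (1 / k) ^ m := by gcongr
      _ = Real.exp (m * (1 / k)) := by rw [← Real.exp_nat_mul]
      _ ≤ Real.exp 1 := by
        gcongr
        rw [mul_one_div, div_le_one (by linarith)]
        exact_mod_cast hdim
  have hsub : (fun w => (1 - 1 / r ^ 2) • x + w) '' (squeeze x k '' Metric.closedBall 0 h) ⊆
      Metric.closedBall (0 : V) (h * r * s) ∩ Metric.closedBall x s := by
    rintro _ ⟨_, ⟨z, hz, rfl⟩, rfl⟩
    rw [mem_closedBall_zero_iff] at hz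
    have hw : ‖squeeze x k z‖ ≤ h := (norm_squeeze_le x z hk').trans hz
    have hxw : |inner ℝ x (squeeze x k z)| ≤ r * h / k := by
      rw [inner_squeeze, abs_div, abs_of_pos (show (0 : ℝ) < k by linarith)]
      gcongr
      exact (abs_real_inner_le_norm x z).trans (by gcongr)
    obtain ⟨h1, h2⟩ := shifted_mem hr.le hk' hx (by rw [← hhsq]; gcongr) hxw
    refine ⟨?_, ?_⟩
    · rw [mem_closedBall_zero_iff]
      refine le_of_sq_le_sq ?_ (by positivity)
      rwa [mul_pow, mul_pow, hhsq, hssq]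
    · rw [mem_closedBall_iff_norm]
      refine le_of_sq_le_sq ?_ hs0.le
      rwa [hssq]
  have hfin : volume (Metric.closedBall (0 : V) (h * r * s) ∩ Metric.closedBall x s) ≠ ⊤ :=
    ne_top_of_le_ne_top measure_closedBall_lt_top.ne (measure_mono Set.inter_subset_left)
  have hreal : ∀ t : ℝ, 0 ≤ t → volume.real (Metric.closedBall (0 : V) t)
      = t ^ m * volume.real (Metric.closedBall (0 : V) 1) := by
    intro t ht
    rw [measureReal_def, Measure.addHaar_closedBall' _ _ ht, ENNReal.toReal_mul,
      ENNReal.toReal_ofReal (by positivity), measureReal_def]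
  have hG : volume.real ((fun w => (1 - 1 / r ^ 2) • x + w) ''
      (squeeze x k '' Metric.closedBall 0 h))
      = |LinearMap.det (squeeze x (k : ℝ))| * volume.real (Metric.closedBall (0 : V) h) := by
    rw [Set.image_add_left, measureReal_def, measure_preimage_add,
      Measure.addHaar_image_linearMap, ENNReal.toReal_mul, ENNReal.toReal_ofReal (abs_nonneg _),
      measureReal_def]
  have hdet : 1 / (k : ℝ) ≤ |LinearMap.det (squeeze x (k : ℝ))| :=
    (inv_le_det_squeeze x hk').trans (le_abs_self _)
  refine le_trans ?_ (measureReal_mono hsub hfin)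
  rw [hG, hreal _ (by positivity), hreal _ hh0.le]
  have hv : 0 ≤ volume.real (Metric.closedBall (0 : V) 1) := measureReal_nonneg
  calc (k * Real.exp 1 * r ^ m)⁻¹ * ((h * r * s) ^ m * volume.real (Metric.closedBall (0 : V) 1))
      = (1 / k) * (h ^ m * volume.real (Metric.closedBall (0 : V) 1)) * (s ^ m / Real.exp 1) := by
        have := Real.exp_pos 1
        rw [mul_pow, mul_pow]
        field_simp
    _ ≤ (1 / k) * (h ^ m * volume.real (Metric.closedBall (0 : V) 1)) * 1 := by
        gcongr
        rw [div_le_one (Real.exp_pos 1)]; exact hsm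
    _ ≤ _ := by
        rw [mul_one]; gcongr

end BallCovering

section EuclideanCover

variable {ι : Type*} [Fintype ι]

/-- A `1 / k`-net of a Euclidean ball, contained in the ball, with logarithmic cardinality
polynomial in `k` and in the radius. -/
lemma exists_net_closedBall {k : ℕ} (hk : 1 ≤ k) (hdim : Fintype.card ι ≤ k) {r : ℝ}
    (hr : 1 ≤ r) :
    ∃ X : Finset (EuclideanSpace ℝ ι), Real.log X.card ≤ 4 * r * k ^ 3 ∧ (∀ y ∈ X, ‖y‖ ≤ r) ∧
      ∀ x : EuclideanSpace ℝ ι, ‖x‖ ≤ r → ∃ y ∈ X, ‖x - y‖ ≤ 1 / k := by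
  classical
  have hk' : (1 : ℝ) ≤ k := by exact_mod_cast hk
  set N : ℕ := ⌈r * k ^ 2⌉₊ with hN
  have hNr : r * k ^ 2 ≤ N := Nat.le_ceil _
  have hNr' : (N : ℝ) < r * k ^ 2 + 1 := Nat.ceil_lt_add_one (by positivity)
  let cells : Finset (ι → ℤ) := Fintype.piFinset fun _ => Finset.Icc (-(N : ℤ)) N
  let InCell : (ι → ℤ) → EuclideanSpace ℝ ι → Prop :=
    fun c y => ‖y‖ ≤ r ∧ ∀ i, ⌊(k : ℝ) ^ 2 * y i⌋ = c i
  let rep : (ι → ℤ) → EuclideanSpace ℝ ι := fun c => if h : ∃ y, InCell c y then h.choose else 0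
  refine ⟨cells.image rep, ?_, ?_, ?_⟩
  · have hcard : (cells.image rep).card ≤ (2 * N + 1) ^ Fintype.card ι := by
      refine Finset.card_image_le.trans ?_
      simp only [cells, Fintype.card_piFinset, Int.card_Icc, Finset.prod_const, Finset.card_univ]
      gcongr
      omega
    have h0 : 0 < (cells.image rep).card := by
      refine Finset.card_pos.2 (Finset.Nonempty.image ⟨fun _ => 0, ?_⟩ _)
      simp [cells, Fintype.mem_piFinset]
    calc Real.log (cells.image rep).card
        ≤ Real.log (((2 * N + 1) ^ Fintype.card ι : ℕ) : ℝ) :=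
          Real.log_le_log (by exact_mod_cast h0) (by exact_mod_cast hcard)
      _ = Fintype.card ι * Real.log (2 * N + 1) := by push_cast; rw [Real.log_pow]
      _ ≤ k * (2 * N) := by
          have h1 := Real.log_le_sub_one_of_pos (show (0 : ℝ) < 2 * N + 1 by positivity)
          have h2 : 0 ≤ Real.log (2 * (N : ℝ) + 1) :=
            Real.log_nonneg (by linarith [N.cast_nonneg (α := ℝ)])
          gcongr
          linarith
      _ ≤ k * (2 * (2 * (r * k ^ 2))) := by
          gcongr
          nlinarith [one_le_pow₀ hk' (n := 2)]
      _ = 4 * r * k ^ 3 := by ring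
  · intro y hy
    obtain ⟨c, -, rfl⟩ := Finset.mem_image.1 hy
    by_cases h : ∃ y, InCell c y
    · simp only [rep, dif_pos h]; exact h.choose_spec.1
    · simp only [rep, dif_neg h, norm_zero]; linarith
  · intro x hx
    let c : ι → ℤ := fun i => ⌊(k : ℝ) ^ 2 * x i⌋
    have hc : ∃ y, InCell c y := ⟨x, hx, fun i => rfl⟩
    refine ⟨rep c, Finset.mem_image_of_mem _ ?_, ?_⟩
    · refine Fintype.mem_piFinset.2 fun i => ?_
      have hxi : |x i| ≤ r := by
        have := PiLp.norm_apply_le x i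
        rw [Real.norm_eq_abs] at this; linarith
      obtain ⟨h1, h2⟩ := abs_le.1 hxi
      have h3 : (k : ℝ) ^ 2 * x i ≤ N := by nlinarith [sq_nonneg (k : ℝ)]
      have h4 : -(N : ℝ) ≤ (k : ℝ) ^ 2 * x i := by nlinarith [sq_nonneg (k : ℝ)]
      rw [Finset.mem_Icc]
      constructor
      · exact Int.le_floor.2 (by push_cast; exact h4)
      · have h5 : ((c i : ℤ) : ℝ) ≤ N := (Int.floor_le ((k : ℝ) ^ 2 * x i)).trans h3
        exact_mod_cast h5
    · have hrep : InCell c (rep c) := by simp only [rep, dif_pos hc]; exact hc.choose_spec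
      have hcoord : ∀ i, (x i - rep c i) ^ 2 ≤ (1 / (k : ℝ) ^ 2) ^ 2 := by
        intro i
        have h1 : |(k : ℝ) ^ 2 * x i - (k : ℝ) ^ 2 * rep c i| < 1 :=
          Int.abs_sub_lt_one_of_floor_eq_floor (hrep.2 i).symm
        rw [← mul_sub, abs_mul, abs_of_pos (show (0 : ℝ) < (k : ℝ) ^ 2 by positivity)] at h1
        rw [← sq_abs]
        gcongr
        rw [le_div_iff₀ (by positivity)]
        linarith
      refine le_of_sq_le_sq ?_ (by positivity)
      rw [EuclideanSpace.real_norm_sq_eq]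
      calc ∑ i, (x - rep c) i ^ 2 ≤ ∑ _i : ι, (1 / (k : ℝ) ^ 2) ^ 2 :=
            Finset.sum_le_sum fun i _ => hcoord i
        _ = Fintype.card ι * (1 / (k : ℝ) ^ 2) ^ 2 := by simp
        _ ≤ k * (1 / (k : ℝ) ^ 2) ^ 2 := by gcongr
        _ ≤ k ^ 2 * (1 / (k : ℝ) ^ 2) ^ 2 := by gcongr; nlinarith
        _ = (1 / (k : ℝ)) ^ 2 := by field_simp

/-- A Euclidean ball of radius `R ≥ 1` in dimension `m ≤ k` is covered by `R ^ m` unit balls, up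
to a factor polynomial in `k` and `R`. -/
lemma exists_unit_cover_closedBall {k : ℕ} (hk : 1 ≤ k) (hdim : Fintype.card ι ≤ k) {R : ℝ}
    (hR : 1 ≤ R) :
    ∃ Y : Finset (EuclideanSpace ℝ ι),
      (Y.card : ℝ) ≤ 300 * k ^ 4 * R * R ^ Fintype.card ι ∧
      ∀ x : EuclideanSpace ℝ ι, ‖x‖ ≤ R → ∃ y ∈ Y, ‖x - y‖ ≤ 1 := by
  classical
  have hk' : (1 : ℝ) ≤ k := by exact_mod_cast hk
  have hk0 : (0 : ℝ) < k := by linarith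
  set a : ℝ := 1 + 2 / k with ha
  have h2k : 0 < 2 / (k : ℝ) := by positivity
  have h2k' : 2 / (k : ℝ) ≤ 2 := by rw [div_le_iff₀ hk0]; linarith
  have ha0 : 0 < a := by positivity
  set r := a * R with hrdef
  have hr : 1 < r := by nlinarith
  have hr3 : r ≤ 3 * R := by rw [hrdef]; gcongr; linarith
  set m := Fintype.card ι with hm
  have hfr : Module.finrank ℝ (EuclideanSpace ℝ ι) = m := finrank_euclideanSpace
  have hrr : 1 / r ^ 2 < 1 := by
    rw [div_lt_one (by positivity)]; nlinarith
  set F := Metric.closedBall (0 : EuclideanSpace ℝ ι) (√(1 - 1 / r ^ 2) * r * √(1 + 2 / k)) with hF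
  have hFrad : 0 < √(1 - 1 / r ^ 2) * r * √(1 + 2 / k) := by
    have : 0 < √(1 - 1 / r ^ 2) := Real.sqrt_pos.2 (by linarith)
    have : 0 < √(1 + 2 / (k : ℝ)) := Real.sqrt_pos.2 (by positivity)
    positivity
  have hFpos : 0 < volume F := Metric.measure_closedBall_pos _ _ hFrad
  have hFtop : volume F ≠ ⊤ :=
    measure_closedBall_lt_top.ne
  have hFreal : 0 < volume.real F := ENNReal.toReal_pos hFpos.ne' hFtop
  let P := ProbabilityTheory.cond volume F
  have : IsProbabilityMeasure P := ProbabilityTheory.cond_isProbabilityMeasure_of_finite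
    hFpos.ne' hFtop
  obtain ⟨X, hXcard, hXr, hXnet⟩ := exists_net_closedBall (ι := ι) hk hdim hr.le
  set p : ℝ := (k * Real.exp 1 * r ^ m)⁻¹ with hp
  have he : 1 ≤ Real.exp 1 := by have := Real.add_one_le_exp 1; linarith
  have hp0 : 0 < p := by have := Real.exp_pos 1; positivity
  have hp1 : p ≤ 1 := by
    refine inv_le_one_of_one_le₀ ?_
    have h1 : 1 ≤ r ^ m := one_le_pow₀ hr.le
    have h2 : 1 ≤ k * Real.exp 1 := one_le_mul_of_one_le_of_one_le hk' he
    exact one_le_mul_of_one_le_of_one_le h2 h1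
  obtain ⟨s, hscard, hs⟩ := exists_hitting P X
    (fun x => Metric.closedBall x √(1 + 2 / (k : ℝ)))
    (fun x => Metric.isClosed_closedBall.measurableSet) hp0 hp1 (by
      intro x hx
      have hvol := volume_shell_inter_ball hr hk (by rw [hfr]; exact hdim) (hXr x hx)
      rw [hfr, ← hp, ← hF] at hvol
      rw [measureReal_def, ProbabilityTheory.cond_apply Metric.isClosed_closedBall.measurableSet,
        ENNReal.toReal_mul, ENNReal.toReal_inv, inv_mul_eq_div]
      exact (le_div_iff₀ hFreal).2 hvol)
  refine ⟨s.image fun y => a⁻¹ • y, ?_, ?_⟩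
  · have hcard : ((s.image fun y => a⁻¹ • y).card : ℝ) ≤ s.card := by
      exact_mod_cast Finset.card_image_le
    have ham : a ^ m ≤ Real.exp 2 := by
      calc a ^ m ≤ Real.exp (2 / k) ^ m := by
            gcongr
            have := Real.add_one_le_exp (2 / (k : ℝ)); linarith
        _ = Real.exp (m * (2 / k)) := by rw [← Real.exp_nat_mul]
        _ ≤ Real.exp 2 := by
          gcongr
          calc (m : ℝ) * (2 / k) ≤ k * (2 / k) := by gcongr
            _ = 2 := by field_simp
    have he3 : Real.exp 1 * Real.exp 2 ≤ 21 := by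
      have h1 := Real.exp_one_lt_d9
      have h2 : Real.exp 2 = Real.exp 1 ^ 2 := by rw [← Real.exp_nat_mul]; norm_num
      calc Real.exp 1 * Real.exp 2 = Real.exp 1 ^ 3 := by rw [h2]; ring
        _ ≤ 2.7182818286 ^ 3 := by gcongr
        _ ≤ 21 := by norm_num
    have hk3 : (1 : ℝ) ≤ k ^ 3 := one_le_pow₀ hk'
    calc ((s.image fun y => a⁻¹ • y).card : ℝ) ≤ (Real.log X.card + 1) / p := hcard.trans hscard
      _ ≤ (4 * r * k ^ 3 + 1) / p := by gcongr
      _ = (4 * r * k ^ 3 + 1) * (k * Real.exp 1 * (a ^ m * R ^ m)) := by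
          rw [hp, div_inv_eq_mul, hrdef, mul_pow]
      _ ≤ (13 * R * k ^ 3) * (k * Real.exp 1 * (Real.exp 2 * R ^ m)) := by
          gcongr
          nlinarith [mul_le_mul_of_nonneg_right hr3 (show (0 : ℝ) ≤ k ^ 3 by positivity),
            one_le_mul_of_one_le_of_one_le hR hk3]
      _ = (13 * k ^ 4 * R * R ^ m) * (Real.exp 1 * Real.exp 2) := by ring
      _ ≤ (13 * k ^ 4 * R * R ^ m) * 21 := by gcongr
      _ ≤ 300 * k ^ 4 * R * R ^ m := by
          have : 0 ≤ k ^ 4 * R * R ^ m := by positivity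
          nlinarith
  · intro x hx
    obtain ⟨z, hz, hxz⟩ := hXnet (a • x) (by
      rw [norm_smul, Real.norm_eq_abs, abs_of_pos ha0]
      exact mul_le_mul_of_nonneg_left hx ha0.le)
    obtain ⟨y, hy, hzy⟩ := hs z hz
    refine ⟨a⁻¹ • y, Finset.mem_image_of_mem _ hy, ?_⟩
    have h1 : x - a⁻¹ • y = a⁻¹ • (a • x - y) := by
      rw [smul_sub, smul_smul, inv_mul_cancel₀ ha0.ne', one_smul]
    rw [h1, norm_smul, norm_inv, Real.norm_eq_abs, abs_of_pos ha0, inv_mul_le_one₀ ha0]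
    have h2 : ‖z - y‖ ≤ 1 + 1 / k := by
      have h3 : √(1 + 2 / (k : ℝ)) ≤ 1 + 1 / k := by
        rw [Real.sqrt_le_left (by positivity)]
        have : 0 < 1 / (k : ℝ) := by positivity
        have e : 2 / (k : ℝ) = 2 * (1 / k) := by ring
        rw [e]; nlinarith
      rw [mem_closedBall_iff_norm, norm_sub_rev] at hzy
      linarith
    calc ‖a • x - y‖ = ‖(a • x - z) + (z - y)‖ := by congr 1; abel
      _ ≤ ‖a • x - z‖ + ‖z - y‖ := norm_add_le _ _
      _ ≤ 1 / k + (1 + 1 / k) := by gcongr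
      _ = a := by rw [ha]; ring

end EuclideanCover

/-- Coordinate form of `exists_unit_cover_closedBall`. -/
lemma exists_unit_cover_finset {ι : Type*} (S : Finset ι) {k : ℕ} (hk : 1 ≤ k) (hS : S.card ≤ k)
    {R : ℝ} (hR : 1 ≤ R) :
    ∃ Y : Finset (ι → ℝ), (Y.card : ℝ) ≤ 300 * k ^ 4 * R * R ^ S.card ∧
      ∀ x : ι → ℝ, ∑ n ∈ S, x n ^ 2 ≤ R ^ 2 → ∃ y ∈ Y, ∑ n ∈ S, (x n - y n) ^ 2 ≤ 1 := by
  classical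
  obtain ⟨Y, hY, hcov⟩ := exists_unit_cover_closedBall (ι := S) hk (by simpa using hS) hR
  refine ⟨Y.image fun y n => if h : n ∈ S then y ⟨n, h⟩ else 0, ?_, ?_⟩
  · rw [Fintype.card_coe] at hY
    exact le_trans (by exact_mod_cast Finset.card_image_le) hY
  · intro x hx
    obtain ⟨y, hy, hxy⟩ := hcov (WithLp.toLp 2 fun n : S => x n) (by
      refine le_of_sq_le_sq ?_ (by linarith)
      rw [EuclideanSpace.real_norm_sq_eq]
      exact (Finset.sum_coe_sort S (fun n => x n ^ 2)).trans_le hx)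
    refine ⟨_, Finset.mem_image_of_mem _ hy, ?_⟩
    have h1 : ‖WithLp.toLp 2 (fun n : S => x n) - y‖ ^ 2 ≤ 1 := by
      simpa using pow_le_pow_left₀ (norm_nonneg _) hxy 2
    rw [EuclideanSpace.real_norm_sq_eq] at h1
    rw [← Finset.sum_coe_sort S]
    simpa using h1

/-- Scaled form of `exists_unit_cover_finset`: dilates of one finite set cover all balls. -/
lemma exists_scaled_cover_finset {ι : Type*} (S : Finset ι) {k : ℕ} (hk : 1 ≤ k)
    (hS : S.card ≤ k) {R : ℝ} (hR : 1 ≤ R) :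
    ∃ Y : Finset (ι → ℝ), (Y.card : ℝ) ≤ 300 * k ^ 4 * R * R ^ S.card ∧ Y.Nonempty ∧
      ∀ t : ℝ, 0 ≤ t → ∀ x : ι → ℝ, ∑ n ∈ S, x n ^ 2 ≤ t ^ 2 * R ^ 2 →
        ∃ y ∈ Y, ∑ n ∈ S, (x n - t * y n) ^ 2 ≤ t ^ 2 := by
  obtain ⟨Y, hY, hcov⟩ := exists_unit_cover_finset S hk hS hR
  have hne : Y.Nonempty := by
    obtain ⟨y, hy, -⟩ := hcov 0 (by simp; positivity)
    exact ⟨y, hy⟩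
  refine ⟨Y, hY, hne, fun t ht x hx => ?_⟩
  rcases ht.eq_or_lt with rfl | ht
  · obtain ⟨y, hy⟩ := hne
    exact ⟨y, hy, by simpa using hx⟩
  · obtain ⟨y, hy, hxy⟩ := hcov (fun n => x n / t) (by
      simp only [div_pow]
      rw [← Finset.sum_div, div_le_iff₀ (by positivity)]
      linarith)
    refine ⟨y, hy, ?_⟩
    calc ∑ n ∈ S, (x n - t * y n) ^ 2 = t ^ 2 * ∑ n ∈ S, (x n / t - y n) ^ 2 := by
          rw [Finset.mul_sum]
          refine Finset.sum_congr rfl fun n _ => ?_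
          field_simp
      _ ≤ t ^ 2 * 1 := by gcongr
      _ = t ^ 2 := mul_one _

/-- A product of `J` finite sets, realised as a finite set of sequences. -/
lemma exists_finset_sequences {α : Type*} [Inhabited α] (J : ℕ) (A : ℕ → Finset α) :
    ∃ G : Finset (ℕ → α), G.card ≤ ∏ j ∈ Finset.range J, (A j).card ∧
      ∀ f : ℕ → α, (∀ j < J, f j ∈ A j) → ∃ g ∈ G, ∀ j < J, g j = f j := by
  classical
  refine ⟨((Finset.range J).pi A).image fun f j => if h : j ∈ Finset.range J then f j h
    else default, ?_, ?_⟩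
  · exact Finset.card_image_le.trans (Finset.card_pi _ _).le
  · intro f hf
    have hmem : (fun j _ => f j) ∈ (Finset.range J).pi A :=
      Finset.mem_pi.2 fun j hj => hf j (Finset.mem_range.1 hj)
    refine ⟨_, Finset.mem_image_of_mem _ hmem, fun j hj => ?_⟩
    simp [hj]

section Hilbert

variable {H : Type*} [NormedAddCommGroup H] [InnerProductSpace ℝ H]

lemma inner_sum_smul {ψ : ℕ → H} (hON : Orthonormal ℝ ψ) (S : Finset ℕ) (a : ℕ → ℝ) (m : ℕ) :
    inner ℝ (ψ m) (∑ n ∈ S, a n • ψ n) = if m ∈ S then a m else 0 := by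
  classical
  simp only [inner_sum, real_inner_smul_right, orthonormal_iff_ite.1 hON, mul_ite, mul_one,
    mul_zero, Finset.sum_ite_eq]

variable [CompleteSpace H]

lemma norm_sq_le_of_forall_sum_le {ψ : ℕ → H} (hON : Orthonormal ℝ ψ)
    (hdense : (Submodule.span ℝ (Set.range ψ)).topologicalClosure = ⊤) (v : H) {B : ℝ}
    (hB : ∀ G : Finset ℕ, ∑ n ∈ G, inner ℝ (ψ n) v ^ 2 ≤ B) : ‖v‖ ^ 2 ≤ B := by
  let b := HilbertBasis.mk hON hdense.ge
  have hs := b.hasSum_inner_mul_inner v v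
  rw [real_inner_self_eq_norm_sq] at hs
  refine hasSum_le_of_sum_le hs fun G => le_trans (le_of_eq ?_) (hB G)
  refine Finset.sum_congr rfl fun n _ => ?_
  simp only [b, HilbertBasis.coe_mk]
  rw [real_inner_comm, sq]

/-- Covering an ellipsoid. The semi-axes above `ε` are grouped into `J` geometric blocks of ratio
`q`; the weights of a point on the blocks are rounded to multiples of `1 / K`, and the component
in each block is approximated with an accuracy proportional to its rounded weight. -/
lemma exists_cover_ellipsoid {ψ : ℕ → H} (hON : Orthonormal ℝ ψ)
    (hdense : (Submodule.span ℝ (Set.range ψ)).topologicalClosure = ⊤)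
    {lam : ℕ → ℝ} (hlam : ∀ n, 0 < lam n) {ε q : ℝ} (hε : 0 < ε) (hq : 1 < q) {J : ℕ}
    (hJ : ∀ n, lam n ≤ ε * q ^ J) {S : Finset ℕ} (hS : ∀ n, n ∈ S ↔ ε < lam n)
    {k : ℕ} (hk : 1 ≤ k) (hSk : S.card ≤ k) {K : ℕ} (hK : 1 ≤ K) :
    ∃ C : Finset H,
      Real.log C.card ≤ J * (Real.log (K + 1) + Real.log 300 + 4 * Real.log k + J * Real.log q)
        + ∑ n ∈ S, (Real.log (lam n / ε) + Real.log q) ∧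
      ∀ x : H, (∀ G : Finset ℕ, ∑ n ∈ G, (inner ℝ (ψ n) x / lam n) ^ 2 ≤ 1) →
        ∃ c ∈ C, ‖x - c‖ ^ 2 ≤ ε ^ 2 * (1 + J / K) := by
  classical
  have hq0 : 0 < q := by linarith
  have hlogq : 0 < Real.log q := Real.log_pos hq
  have hK0 : (0 : ℝ) < K := by exact_mod_cast hK
  have hk0 : (0 : ℝ) < k := by exact_mod_cast hk
  have hblock : ∀ n, ∃ j, n ∈ S → j < J ∧ ε * q ^ j < lam n ∧ lam n ≤ ε * q ^ (j + 1) := by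
    intro n
    by_cases hn : n ∈ S
    · have hex : ∃ i, lam n ≤ ε * q ^ i := ⟨J, hJ n⟩
      have h0 : Nat.find hex ≠ 0 := by
        intro h
        have := Nat.find_spec hex
        rw [h, pow_zero, mul_one] at this
        exact absurd ((hS n).1 hn) (not_lt.2 this)
      obtain ⟨j, hj⟩ := Nat.exists_eq_succ_of_ne_zero h0
      refine ⟨j, fun _ => ⟨?_, ?_, ?_⟩⟩
      · have := Nat.find_min' hex (hJ n)
        omega
      · exact not_le.1 (Nat.find_min hex (m := j) (by omega))
      · have := Nat.find_spec hex
        rwa [hj] at this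
    · exact ⟨0, fun h => absurd h hn⟩
  choose bl hbl using hblock
  let B : ℕ → Finset ℕ := fun j => S.filter fun n => bl n = j
  have hBS : ∀ j, (B j).card ≤ k := fun j => (Finset.card_filter_le _ _).trans hSk
  have hmaps : ∀ n ∈ S, bl n ∈ Finset.range J := fun n hn => Finset.mem_range.2 (hbl n hn).1
  choose Y hYcard hYne hY using fun j =>
    exists_scaled_cover_finset (B j) hk (hBS j) (one_le_pow₀ hq.le (n := j + 1))
  obtain ⟨G, hGcard, hG⟩ := exists_finset_sequences (α := ℕ × (ℕ → ℝ)) J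
    fun j => Finset.range (K + 1) ×ˢ Y j
  let ctr : (ℕ → ℕ × (ℕ → ℝ)) → ℕ → ℝ :=
    fun g n => ε * √((g (bl n)).1 / K) * (g (bl n)).2 n
  have hcover : ∀ x : H, (∀ G : Finset ℕ, ∑ n ∈ G, (inner ℝ (ψ n) x / lam n) ^ 2 ≤ 1) →
      ∃ c ∈ G.image fun g => ∑ n ∈ S, ctr g n • ψ n, ‖x - c‖ ^ 2 ≤ ε ^ 2 * (1 + J / K) := by
    intro x hx
    set w : ℕ → ℝ := fun n => (inner ℝ (ψ n) x / lam n) ^ 2 with hw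
    have hw0 : ∀ n, 0 ≤ w n := fun n => sq_nonneg _
    have hwx : ∀ n, inner ℝ (ψ n) x ^ 2 = w n * lam n ^ 2 := fun n => by
      have := (hlam n).ne'
      simp only [hw]; field_simp
    let p : ℕ → ℕ := fun j => ⌈(K : ℝ) * ∑ n ∈ B j, w n⌉₊
    have hwB0 : ∀ j, 0 ≤ ∑ n ∈ B j, w n := fun j => Finset.sum_nonneg fun n _ => hw0 n
    have hp_ge : ∀ j, ∑ n ∈ B j, w n ≤ p j / K := fun j => by
      rw [le_div_iff₀ hK0, mul_comm]; exact Nat.le_ceil _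
    have hp_le : ∀ j, (p j : ℝ) / K ≤ ∑ n ∈ B j, w n + 1 / K := fun j => by
      rw [div_le_iff₀ hK0, add_mul, one_div_mul_cancel hK0.ne', mul_comm]
      exact (Nat.ceil_lt_add_one (mul_nonneg hK0.le (hwB0 j))).le
    have hp_K : ∀ j, p j ≤ K := fun j => by
      refine Nat.ceil_le.2 ?_
      have := hx (B j)
      nlinarith
    have hy : ∀ j, ∃ y ∈ Y j, ∑ n ∈ B j, (inner ℝ (ψ n) x - ε * √(p j / K) * y n) ^ 2
        ≤ ε ^ 2 * (p j / K) := by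
      intro j
      have hsq : (ε * √((p j : ℝ) / K)) ^ 2 = ε ^ 2 * (p j / K) := by
        rw [mul_pow, Real.sq_sqrt (by positivity)]
      obtain ⟨y, hy, hle⟩ := hY j (ε * √(p j / K)) (by positivity)
        (fun n => inner ℝ (ψ n) x) (by
          rw [hsq]
          calc ∑ n ∈ B j, inner ℝ (ψ n) x ^ 2 ≤ ∑ n ∈ B j, w n * (ε * q ^ (j + 1)) ^ 2 := by
                refine Finset.sum_le_sum fun n hn => ?_
                obtain ⟨hnS, hnj⟩ := Finset.mem_filter.1 hn
                rw [hwx]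
                have h1 := (hbl n hnS).2.2
                rw [hnj] at h1
                exact mul_le_mul_of_nonneg_left (pow_le_pow_left₀ (hlam n).le h1 2) (hw0 n)
            _ = (∑ n ∈ B j, w n) * (ε * q ^ (j + 1)) ^ 2 := by rw [Finset.sum_mul]
            _ ≤ (p j / K) * (ε * q ^ (j + 1)) ^ 2 := by gcongr; exact hp_ge j
            _ = _ := by ring)
      exact ⟨y, hy, hle.trans hsq.le⟩
    choose y hyY hyle using hy
    obtain ⟨g, hgG, hg⟩ := hG (fun j => (p j, y j)) fun j _ => by
      simp only [Finset.mem_product, Finset.mem_range]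
      exact ⟨Nat.lt_succ_of_le (hp_K j), hyY j⟩
    refine ⟨_, Finset.mem_image_of_mem _ hgG, ?_⟩
    refine norm_sq_le_of_forall_sum_le hON hdense _ fun F => ?_
    have hhead : ∑ n ∈ S, inner ℝ (ψ n) (x - ∑ n ∈ S, ctr g n • ψ n) ^ 2
        ≤ ε ^ 2 * (∑ n ∈ S, w n + J / K) := by
      rw [← Finset.sum_fiberwise_of_maps_to hmaps, ← Finset.sum_fiberwise_of_maps_to hmaps w]
      calc _ ≤ ∑ j ∈ Finset.range J, ε ^ 2 * (∑ n ∈ B j, w n + 1 / K) := by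
            refine Finset.sum_le_sum fun j hj => ?_
            refine le_trans (le_of_eq ?_) ((hyle j).trans
              (mul_le_mul_of_nonneg_left (hp_le j) (sq_nonneg ε)))
            refine Finset.sum_congr rfl fun n hn => ?_
            obtain ⟨hnS, hnj⟩ := Finset.mem_filter.1 hn
            rw [inner_sub_right, inner_sum_smul hON, if_pos hnS]
            simp only [ctr, hnj, hg j (Finset.mem_range.1 hj)]
        _ = _ := by
            rw [← Finset.mul_sum, Finset.sum_add_distrib]
            simp [B, div_eq_mul_inv]
    have htail : ∑ n ∈ F \ S, inner ℝ (ψ n) (x - ∑ n ∈ S, ctr g n • ψ n) ^ 2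
        ≤ ε ^ 2 * ∑ n ∈ F \ S, w n := by
      rw [Finset.mul_sum]
      refine Finset.sum_le_sum fun n hn => ?_
      have hnS := (Finset.mem_sdiff.1 hn).2
      rw [inner_sub_right, inner_sum_smul hON, if_neg hnS, sub_zero, hwx, mul_comm]
      have h1 : lam n ≤ ε := not_lt.1 fun h => hnS ((hS n).2 h)
      exact mul_le_mul_of_nonneg_right (pow_le_pow_left₀ (hlam n).le h1 2) (hw0 n)
    have hun : ∑ n ∈ S, w n + ∑ n ∈ F \ S, w n ≤ 1 := by
      rw [← Finset.sum_union Finset.disjoint_sdiff]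
      exact hx _
    calc ∑ n ∈ F, inner ℝ (ψ n) (x - ∑ n ∈ S, ctr g n • ψ n) ^ 2
        ≤ ∑ n ∈ S ∪ F \ S, inner ℝ (ψ n) (x - ∑ n ∈ S, ctr g n • ψ n) ^ 2 := by
          refine Finset.sum_le_sum_of_subset_of_nonneg (fun n hn => ?_) fun n _ _ => sq_nonneg _
          simp only [Finset.mem_union, Finset.mem_sdiff]; tauto
      _ ≤ ε ^ 2 * (∑ n ∈ S, w n + J / K) + ε ^ 2 * ∑ n ∈ F \ S, w n := by
          rw [Finset.sum_union Finset.disjoint_sdiff]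
          exact add_le_add hhead htail
      _ = ε ^ 2 * ((∑ n ∈ S, w n + ∑ n ∈ F \ S, w n) + J / K) := by ring
      _ ≤ ε ^ 2 * (1 + J / K) := by gcongr
  refine ⟨_, ?_, hcover⟩
  obtain ⟨c, hc, -⟩ := hcover 0 (by simp)
  have hCpos : 0 < (G.image fun g => ∑ n ∈ S, ctr g n • ψ n).card := Finset.card_pos.2 ⟨c, hc⟩
  have hYpos : ∀ j, (0 : ℝ) < (Y j).card := fun j => by exact_mod_cast (hYne j).card_pos
  have hlogY : ∀ j ∈ Finset.range J, Real.log (((Finset.range (K + 1) ×ˢ Y j).card : ℕ) : ℝ)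
      ≤ (Real.log (K + 1) + Real.log 300 + 4 * Real.log k + J * Real.log q)
        + ∑ n ∈ B j, (Real.log (lam n / ε) + Real.log q) := by
    intro j hj
    have hjJ : (j : ℝ) + 1 ≤ J := by exact_mod_cast Finset.mem_range.1 hj
    have h1 : Real.log (Y j).card ≤ Real.log 300 + 4 * Real.log k + (j + 1) * Real.log q
        + (B j).card * ((j + 1) * Real.log q) := by
      refine (Real.log_le_log (hYpos j) (hYcard j)).trans (le_of_eq ?_)
      rw [Real.log_mul (by positivity) (by positivity), Real.log_mul (by positivity)
        (by positivity), Real.log_mul (by positivity) (by positivity), Real.log_pow, Real.log_pow,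
        Real.log_pow, Real.log_pow]
      push_cast; ring
    have h2 : (B j).card * ((j + 1) * Real.log q)
        ≤ ∑ n ∈ B j, (Real.log (lam n / ε) + Real.log q) := by
      rw [← nsmul_eq_mul]
      refine Finset.card_nsmul_le_sum _ _ _ fun n hn => ?_
      obtain ⟨hnS, hnj⟩ := Finset.mem_filter.1 hn
      have h3 := (hbl n hnS).2.1
      rw [hnj] at h3
      have h4 : Real.log (q ^ j) ≤ Real.log (lam n / ε) :=
        Real.log_le_log (by positivity) (by rw [le_div_iff₀ hε]; linarith)
      rw [Real.log_pow] at h4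
      linarith
    have h3 : ((j : ℝ) + 1) * Real.log q ≤ J * Real.log q := by gcongr
    rw [Finset.card_product, Finset.card_range, Nat.cast_mul,
      Real.log_mul (by positivity) (hYpos j).ne']
    push_cast
    linarith
  calc Real.log ((G.image fun g => ∑ n ∈ S, ctr g n • ψ n).card : ℕ)
      ≤ Real.log ((∏ j ∈ Finset.range J, (Finset.range (K + 1) ×ˢ Y j).card : ℕ) : ℝ) :=
        Real.log_le_log (by exact_mod_cast hCpos)
          (by exact_mod_cast Finset.card_image_le.trans hGcard)
    _ = ∑ j ∈ Finset.range J, Real.log (((Finset.range (K + 1) ×ˢ Y j).card : ℕ) : ℝ) := by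
        rw [Nat.cast_prod, Real.log_prod]
        intro j _
        have := (hYne j).card_pos
        rw [Finset.card_product, Finset.card_range]
        positivity
    _ ≤ _ := Finset.sum_le_sum hlogY
    _ = _ := by
        rw [Finset.sum_add_distrib, Finset.sum_const, Finset.card_range, nsmul_eq_mul,
          Finset.sum_fiberwise_of_maps_to hmaps]

end Hilbert

section Ellipsoid

variable {H : Type*} [NormedAddCommGroup H] [InnerProductSpace ℝ H]

lemma inner_eigenvector_apply [CompleteSpace H] {T : H →L[ℝ] H} (hT : T.IsPositive) {ψ : ℕ → H}
    {lam : ℕ → ℝ} (heig : ∀ n, T (ψ n) = lam n • ψ n) (n : ℕ) (b : H) :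
    inner ℝ (ψ n) (T b) = lam n * inner ℝ (ψ n) b := by
  rw [← hT.inner_left_eq_inner_right, heig, real_inner_smul_left]

lemma sum_sq_le_norm_sq {ψ : ℕ → H} (hON : Orthonormal ℝ ψ) (G : Finset ℕ) (x : H) :
    ∑ n ∈ G, inner ℝ (ψ n) x ^ 2 ≤ ‖x‖ ^ 2 := by
  simpa using hON.sum_inner_products_le (s := G) x

lemma sum_sq_le_one_of_mem_closure [CompleteSpace H] {T : H →L[ℝ] H} (hT : T.IsPositive)
    {ψ : ℕ → H} (hON : Orthonormal ℝ ψ) {lam : ℕ → ℝ} (heig : ∀ n, T (ψ n) = lam n • ψ n)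
    (hlam : ∀ n, 0 < lam n) {x : H} (hx : x ∈ closure (T '' Metric.closedBall 0 1))
    (G : Finset ℕ) : ∑ n ∈ G, (inner ℝ (ψ n) x / lam n) ^ 2 ≤ 1 := by
  have hcl : IsClosed {x : H | ∑ n ∈ G, (inner ℝ (ψ n) x / lam n) ^ 2 ≤ 1} :=
    isClosed_le (by fun_prop) continuous_const
  refine closure_minimal ?_ hcl hx
  rintro _ ⟨b, hb, rfl⟩
  rw [mem_closedBall_zero_iff] at hb
  calc ∑ n ∈ G, (inner ℝ (ψ n) (T b) / lam n) ^ 2 = ∑ n ∈ G, inner ℝ (ψ n) b ^ 2 :=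
        Finset.sum_congr rfl fun n _ => by
          rw [inner_eigenvector_apply hT heig, mul_div_cancel_left₀ _ (hlam n).ne']
    _ ≤ ‖b‖ ^ 2 := sum_sq_le_norm_sq hON G b
    _ ≤ 1 := pow_le_one₀ (norm_nonneg _) hb

/-- Volume bound: covers of the image of the unit ball have at least `∏ (lam n / ε)` elements. -/
lemma prod_div_le_card_of_cover {T : H →L[ℝ] H} {ψ : ℕ → H} (hON : Orthonormal ℝ ψ)
    {lam : ℕ → ℝ} (heig : ∀ n, T (ψ n) = lam n • ψ n) (hlam : ∀ n, 0 < lam n) {ε : ℝ}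
    (hε : 0 < ε) (S : Finset ℕ) (C : Finset H)
    (hC : ∀ x ∈ closure (T '' Metric.closedBall 0 1), ∃ y ∈ C, dist x y ≤ ε) :
    ∏ n ∈ S, (lam n / ε) ≤ C.card := by
  classical
  let π : H → EuclideanSpace ℝ S := fun x => WithLp.toLp 2 fun n : S => inner ℝ (ψ n) x
  have hπ : ∀ x y, ‖π x - π y‖ ≤ ‖x - y‖ := by
    intro x y
    refine le_of_sq_le_sq ?_ (norm_nonneg _)
    rw [EuclideanSpace.real_norm_sq_eq]
    refine le_trans (le_of_eq ?_) (sum_sq_le_norm_sq hON S (x - y))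
    rw [← Finset.sum_coe_sort S]
    exact Finset.sum_congr rfl fun n _ => by simp [π, inner_sub_right]
  let D : EuclideanSpace ℝ S →ₗ[ℝ] EuclideanSpace ℝ S :=
    Matrix.toLpLin 2 2 (Matrix.diagonal fun n : S => lam n)
  have hsub : D '' Metric.closedBall 0 1 ⊆ ⋃ c ∈ C, Metric.closedBall (π c) ε := by
    rintro _ ⟨v, hv, rfl⟩
    rw [mem_closedBall_zero_iff] at hv
    let b : H := ∑ n : S, v n • ψ n
    have hbn : ‖b‖ ^ 2 = ‖v‖ ^ 2 := by
      have := (hON.comp ((↑) : S → ℕ) Subtype.val_injective).inner_sum v v Finset.univ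
      rw [← real_inner_self_eq_norm_sq, EuclideanSpace.real_norm_sq_eq]
      simp only [b]
      refine this.trans (Finset.sum_congr rfl fun n _ => ?_)
      simp [sq]
    have hb : ‖b‖ ≤ 1 := by
      refine le_of_sq_le_sq ?_ zero_le_one
      rw [hbn]; exact pow_le_pow_left₀ (norm_nonneg _) hv 2
    have hDv : π (T b) = D v := by
      ext n
      have h1 : T b = ∑ m : S, (v m * lam m) • ψ m := by
        simp only [b, map_sum, map_smul, heig, smul_smul]
      have h2 := (hON.comp ((↑) : S → ℕ) Subtype.val_injective).inner_right_fintype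
        (fun m : S => v m * lam m) n
      simp only [Function.comp_apply] at h2
      simp only [π, D, h1, h2, Matrix.toLpLin_apply, Matrix.mulVec_diagonal]
      ring
    obtain ⟨c, hc, hdist⟩ := hC (T b) (subset_closure ⟨b, by simpa using hb, rfl⟩)
    refine Set.mem_iUnion₂.2 ⟨c, hc, ?_⟩
    rw [mem_closedBall_iff_norm, ← hDv]
    exact (hπ _ _).trans (by rwa [← dist_eq_norm])
  have hvol1 : 0 < volume (Metric.closedBall (0 : EuclideanSpace ℝ S) 1) :=
    Metric.measure_closedBall_pos _ _ one_pos
  have hvol1' : volume (Metric.closedBall (0 : EuclideanSpace ℝ S) 1) ≠ ⊤ :=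
    measure_closedBall_lt_top.ne
  have hreal : 0 < volume.real (Metric.closedBall (0 : EuclideanSpace ℝ S) 1) :=
    ENNReal.toReal_pos hvol1.ne' hvol1'
  have hball : ∀ c : EuclideanSpace ℝ S, volume.real (Metric.closedBall c ε)
      = ε ^ S.card * volume.real (Metric.closedBall (0 : EuclideanSpace ℝ S) 1) := by
    intro c
    rw [measureReal_def, Measure.addHaar_closedBall' _ _ hε.le, ENNReal.toReal_mul,
      ENNReal.toReal_ofReal (by positivity), measureReal_def, finrank_euclideanSpace,
      Fintype.card_coe]
  have hdet : LinearMap.det D = ∏ n ∈ S, lam n := by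
    rw [← Finset.prod_coe_sort S, ← Matrix.det_diagonal]
    exact LinearMap.det_toLpLin 2 _
  have hpos : 0 < ∏ n ∈ S, lam n := Finset.prod_pos fun n _ => hlam n
  have hD : volume.real (D '' Metric.closedBall 0 1)
      = (∏ n ∈ S, lam n) * volume.real (Metric.closedBall (0 : EuclideanSpace ℝ S) 1) := by
    rw [measureReal_def, Measure.addHaar_image_linearMap, ENNReal.toReal_mul,
      ENNReal.toReal_ofReal (abs_nonneg _), hdet, abs_of_pos hpos, measureReal_def]
  have hle : volume.real (D '' Metric.closedBall 0 1)
      ≤ ∑ c ∈ C, volume.real (Metric.closedBall (π c) ε) := by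
    refine le_trans (measureReal_mono hsub ?_) (measureReal_biUnion_finset_le C _)
    exact (measure_biUnion_lt_top C.finite_toSet fun c _ => measure_closedBall_lt_top).ne
  rw [hD] at hle
  simp only [hball, Finset.sum_const, nsmul_eq_mul] at hle
  rw [← mul_assoc] at hle
  have := le_of_mul_le_mul_right hle hreal
  rw [Finset.prod_div_distrib, Finset.prod_const, div_le_iff₀ (by positivity)]
  exact this

end Ellipsoid

/-- The indices `n` with `γ ≤ lam n`, as a finite set (empty if there are infinitely many). -/
def indicesGE (lam : ℕ → ℝ) (γ : ℝ) : Finset ℕ :=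
  open Classical in if h : {n : ℕ | γ ≤ lam n}.Finite then h.toFinset else ∅

/-- The sum of `log (lam n / ε)` over the `n` with `lam n ≥ ε`. -/
def logSum (lam : ℕ → ℝ) (ε : ℝ) : ℝ := ∑ n ∈ indicesGE lam ε, Real.log (lam n / ε)

lemma card_indicesGE (lam : ℕ → ℝ) (γ : ℝ) :
    Nat.card {n : ℕ | γ ≤ lam n} = (indicesGE lam γ).card := by
  by_cases h : {n : ℕ | γ ≤ lam n}.Finite
  · rw [indicesGE, dif_pos h, Nat.card_coe_set_eq, Set.ncard_eq_toFinset_card _ h]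
  · rw [indicesGE, dif_neg h, Nat.card_coe_set_eq, Set.Infinite.ncard h, Finset.card_empty]

lemma mem_indicesGE {lam : ℕ → ℝ} {γ : ℝ} (h : {n : ℕ | γ ≤ lam n}.Finite) {n : ℕ} :
    n ∈ indicesGE lam γ ↔ γ ≤ lam n := by
  rw [indicesGE, dif_pos h, Set.Finite.mem_toFinset, Set.mem_ofPred_eq]

/-- Two-sided bounds for the logarithm of the covering number at scale `ε`, where `a` is the
relative width of the blocks. -/
lemma logSum_le_log_coveringNumber_le
    {H : Type*} [NormedAddCommGroup H] [InnerProductSpace ℝ H] [CompleteSpace H]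
    {T : H →L[ℝ] H} (hT : T.IsPositive) {ψ : ℕ → H} (hON : Orthonormal ℝ ψ)
    (hdense : (Submodule.span ℝ (Set.range ψ)).topologicalClosure = ⊤)
    {lam : ℕ → ℝ} (heig : ∀ n, T (ψ n) = lam n • ψ n) (hlam : ∀ n, 0 < lam n)
    (hfin : ∀ γ > 0, {n : ℕ | γ ≤ lam n}.Finite) {ε a : ℝ} (hε : 0 < ε) (ha : 0 < a)
    {J : ℕ} (hJ : ∀ n, lam n ≤ ε / (1 + a) * (1 + a) ^ J) {K : ℕ} (hK : 1 ≤ K)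
    (hJK : J ≤ a * K) :
    logSum lam ε ≤ Real.log (coveringNumber ε (closure (T '' Metric.closedBall 0 1))) ∧
    Real.log (coveringNumber ε (closure (T '' Metric.closedBall 0 1))) ≤ logSum lam ε
      + 2 * a * (indicesGE lam (ε / (1 + a))).card
      + J * (Real.log (K + 1) + Real.log 300
        + 4 * Real.log ((indicesGE lam (ε / (1 + a))).card + 1) + J * Real.log (1 + a)) := by
  classical
  set δ := ε / (1 + a) with hδ
  have hδ0 : 0 < δ := by positivity
  have hδε : δ ≤ ε := div_le_self hε.le (by linarith)
  have hK0 : (0 : ℝ) < K := by exact_mod_cast hK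
  set S := (indicesGE lam δ).filter fun n => δ < lam n with hSdef
  have hS : ∀ n, n ∈ S ↔ δ < lam n := fun n => by
    rw [hSdef, Finset.mem_filter, mem_indicesGE (hfin δ hδ0)]
    exact ⟨fun h => h.2, fun h => ⟨h.le, h⟩⟩
  have hScard : S.card ≤ (indicesGE lam δ).card := Finset.card_filter_le _ _
  obtain ⟨C, hClog, hC⟩ := exists_cover_ellipsoid hON hdense hlam hδ0 (by linarith) hJ hS
    (k := (indicesGE lam δ).card + 1) (by omega) (by omega) hK
  have hCcov : ∀ x ∈ closure (T '' Metric.closedBall 0 1), ∃ y ∈ C, dist x y ≤ ε := by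
    intro x hx
    obtain ⟨c, hc, hxc⟩ := hC x (sum_sq_le_one_of_mem_closure hT hON heig hlam hx)
    refine ⟨c, hc, ?_⟩
    rw [dist_eq_norm]
    refine le_of_sq_le_sq (hxc.trans ?_) hε.le
    have h1 : (J : ℝ) / K ≤ a := by rw [div_le_iff₀ hK0]; exact hJK
    have h2 : ε = δ * (1 + a) := by rw [hδ]; field_simp
    rw [h2, mul_pow]
    gcongr
    nlinarith
  set N := coveringNumber ε (closure (T '' Metric.closedBall 0 1)) with hN
  have hmem : C.card ∈ {n : ℕ | ∃ s : Finset H, s.card = n ∧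
      ∀ x ∈ closure (T '' Metric.closedBall 0 1), ∃ y ∈ s, dist x y ≤ ε} := ⟨C, rfl, hCcov⟩
  have hNC : N ≤ C.card := Nat.sInf_le hmem
  obtain ⟨C', hC'card, hC'⟩ := Nat.sInf_mem ⟨_, hmem⟩
  have hlow : ∏ n ∈ indicesGE lam ε, (lam n / ε) ≤ N := by
    have := prod_div_le_card_of_cover hON heig hlam hε (indicesGE lam ε) C' hC'
    rw [hC'card] at this
    exact this
  have hprod : 0 < ∏ n ∈ indicesGE lam ε, (lam n / ε) :=
    Finset.prod_pos fun n _ => div_pos (hlam n) hε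
  have hN0 : (0 : ℝ) < N := hprod.trans_le hlow
  refine ⟨?_, ?_⟩
  · rw [logSum, ← Real.log_prod fun n _ => (div_pos (hlam n) hε).ne']
    exact Real.log_le_log hprod hlow
  · have h1 : Real.log N ≤ Real.log C.card := Real.log_le_log hN0 (by exact_mod_cast hNC)
    have hloga : Real.log (1 + a) ≤ a := by
      have := Real.log_le_sub_one_of_pos (show 0 < 1 + a by linarith); linarith
    have hloga0 : 0 ≤ Real.log (1 + a) := Real.log_nonneg (by linarith)
    have h2 : ∑ n ∈ S, (Real.log (lam n / δ) + Real.log (1 + a))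
        ≤ logSum lam ε + 2 * a * (indicesGE lam δ).card := by
      have h3 : ∀ n ∈ S, Real.log (lam n / δ) + Real.log (1 + a)
          ≤ Real.log (lam n / ε) + 2 * a := fun n _ => by
        have : lam n / δ = lam n / ε * (1 + a) := by rw [hδ]; field_simp
        rw [this, Real.log_mul (div_pos (hlam n) hε).ne' (by linarith)]
        linarith
      have h4 : ∑ n ∈ S, Real.log (lam n / ε) ≤ logSum lam ε := by
        rw [logSum, ← Finset.sum_filter_add_sum_filter_not S fun n => ε ≤ lam n]
        have h5 : ∑ n ∈ S.filter (fun n => ¬ ε ≤ lam n), Real.log (lam n / ε) ≤ 0 :=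
          Finset.sum_nonpos fun n hn => Real.log_nonpos (div_pos (hlam n) hε).le (by
            rw [div_le_one hε]; exact (not_le.1 (Finset.mem_filter.1 hn).2).le)
        have h6 : ∑ n ∈ S.filter (fun n => ε ≤ lam n), Real.log (lam n / ε)
            ≤ ∑ n ∈ indicesGE lam ε, Real.log (lam n / ε) := by
          refine Finset.sum_le_sum_of_subset_of_nonneg (fun n hn => ?_) fun n hn _ => ?_
          · exact (mem_indicesGE (hfin ε hε)).2 (Finset.mem_filter.1 hn).2
          · refine Real.log_nonneg ?_
            rw [one_le_div hε]; exact (mem_indicesGE (hfin ε hε)).1 hn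
        linarith
      calc _ ≤ ∑ n ∈ S, (Real.log (lam n / ε) + 2 * a) := Finset.sum_le_sum h3
        _ = ∑ n ∈ S, Real.log (lam n / ε) + 2 * a * S.card := by
            rw [Finset.sum_add_distrib, Finset.sum_const, nsmul_eq_mul]; ring
        _ ≤ _ := by gcongr
    push_cast at hClog
    linarith

section CountingFunction

variable {lam : ℕ → ℝ}

lemma intervalIntegrable_indicator_inv {ε γ t : ℝ} (hε : 0 < ε) (hεγ : ε ≤ γ) :
    IntervalIntegrable ({x : ℝ | x ≤ t}.indicator fun x => x⁻¹) volume ε γ := by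
  have h : IntervalIntegrable (fun x : ℝ => x⁻¹) volume ε γ :=
    intervalIntegral.intervalIntegrable_inv (fun x hx => by
      rw [Set.uIcc_of_le hεγ] at hx; exact (hε.trans_le hx.1).ne') continuousOn_id
  rw [intervalIntegrable_iff] at h ⊢
  exact h.indicator measurableSet_Iic

lemma sum_indicator_eq_card_div (hfin : ∀ γ > 0, {n : ℕ | γ ≤ lam n}.Finite) {ε x : ℝ}
    (hε : 0 < ε) (hx : ε ≤ x) :
    ∑ n ∈ indicesGE lam ε, {y : ℝ | y ≤ lam n}.indicator (fun y => y⁻¹) x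
      = (indicesGE lam x).card * x⁻¹ := by
  classical
  have h1 : (indicesGE lam ε).filter (fun n => x ≤ lam n) = indicesGE lam x := by
    ext n
    rw [Finset.mem_filter, mem_indicesGE (hfin ε hε), mem_indicesGE (hfin x (hε.trans_le hx))]
    exact ⟨fun h => h.2, fun h => ⟨hx.trans h, h⟩⟩
  rw [← h1, ← nsmul_eq_mul, ← Finset.sum_const, Finset.sum_filter]
  exact Finset.sum_congr rfl fun n _ => by simp [Set.indicator_apply]

lemma intervalIntegrable_card_div (hfin : ∀ γ > 0, {n : ℕ | γ ≤ lam n}.Finite) {ε γ : ℝ}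
    (hε : 0 < ε) (hεγ : ε ≤ γ) :
    IntervalIntegrable (fun x => (indicesGE lam x).card * x⁻¹) volume ε γ := by
  have h := IntervalIntegrable.sum (indicesGE lam ε) fun n _ =>
    intervalIntegrable_indicator_inv (t := lam n) hε hεγ
  refine h.congr fun x hx => ?_
  rw [Set.uIoc_of_le hεγ] at hx
  simpa using sum_indicator_eq_card_div hfin hε hx.1.le

lemma integral_indicator_inv {ε γ t : ℝ} (hε : 0 < ε) (hεγ : ε ≤ γ) (hεt : ε ≤ t) :
    ∫ x in ε..γ, {y : ℝ | y ≤ t}.indicator (fun y => y⁻¹) x = Real.log (min t γ / ε) := by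
  have h0 : 0 < min t γ := lt_min (hε.trans_le hεt) (hε.trans_le hεγ)
  rw [← integral_inv_of_pos hε h0, ← intervalIntegral.integral_indicator
    (⟨le_min hεt hεγ, min_le_right _ _⟩ : min t γ ∈ Set.Icc ε γ)]
  refine intervalIntegral.integral_congr fun x hx => ?_
  rw [Set.uIcc_of_le hεγ] at hx
  simp [Set.indicator_apply, hx.2]

lemma logSum_eq_integral (hlam : ∀ n, 0 < lam n)
    (hfin : ∀ γ > 0, {n : ℕ | γ ≤ lam n}.Finite) {ε γ : ℝ} (hε : 0 < ε) (hεγ : ε ≤ γ) :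
    logSum lam ε = (∫ x in ε..γ, (indicesGE lam x).card * x⁻¹) + logSum lam γ := by
  have hγ : 0 < γ := hε.trans_le hεγ
  have h1 : ∫ x in ε..γ, (indicesGE lam x).card * x⁻¹
      = ∑ n ∈ indicesGE lam ε, Real.log (min (lam n) γ / ε) := by
    rw [← Finset.sum_congr rfl fun n hn =>
      integral_indicator_inv hε hεγ ((mem_indicesGE (hfin ε hε)).1 hn),
      ← intervalIntegral.integral_finsetSum fun n _ => intervalIntegrable_indicator_inv hε hεγ]
    refine intervalIntegral.integral_congr fun x hx => ?_
    rw [Set.uIcc_of_le hεγ] at hx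
    exact (sum_indicator_eq_card_div hfin hε hx.1).symm
  have hsub : indicesGE lam γ ⊆ indicesGE lam ε := fun n hn =>
    (mem_indicesGE (hfin ε hε)).2 (hεγ.trans ((mem_indicesGE (hfin γ hγ)).1 hn))
  have h2 : logSum lam γ = ∑ n ∈ indicesGE lam ε, Real.log (lam n / min (lam n) γ) := by
    rw [logSum, ← Finset.sum_subset_zero_on_sdiff hsub (fun n hn => ?_) fun n hn => ?_]
    · have := (Finset.mem_sdiff.1 hn).2
      rw [mem_indicesGE (hfin γ hγ), not_le] at this
      rw [min_eq_left this.le, div_self (hlam n).ne', Real.log_one]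
    · rw [min_eq_right ((mem_indicesGE (hfin γ hγ)).1 hn)]
  rw [h1, h2, ← Finset.sum_add_distrib, logSum]
  refine Finset.sum_congr rfl fun n _ => ?_
  have h0 : 0 < min (lam n) γ := lt_min (hlam n) hγ
  rw [← Real.log_mul (div_pos h0 hε).ne' (div_pos (hlam n) h0).ne']
  congr 1
  field_simp

lemma integral_rpow_neg_mul_inv {ε γ β : ℝ} (hε : 0 < ε) (hεγ : ε ≤ γ) (hβ : 0 < β) :
    ∫ x in ε..γ, x ^ (-β) * x⁻¹ = (ε ^ (-β) - γ ^ (-β)) / β := by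
  have h0 : (0 : ℝ) ∉ Set.uIcc ε γ := by
    rw [Set.uIcc_of_le hεγ]; exact fun h => hε.not_ge h.1
  have h1 : ∫ x in ε..γ, x ^ (-β) * x⁻¹ = ∫ x in ε..γ, x ^ (-β - 1) := by
    refine intervalIntegral.integral_congr fun x hx => ?_
    rw [Set.uIcc_of_le hεγ] at hx
    rw [Real.rpow_sub_one (hε.trans_le hx.1).ne', div_eq_mul_inv]
  rw [h1, integral_rpow (Or.inr ⟨by linarith, h0⟩), sub_add_cancel]
  field_simp
  ring

lemma intervalIntegrable_rpow_neg_mul_inv {ε γ : ℝ} (hε : 0 < ε) (hεγ : ε ≤ γ) (β : ℝ) :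
    IntervalIntegrable (fun x : ℝ => x ^ (-β) * x⁻¹) volume ε γ := by
  refine ContinuousOn.intervalIntegrable_of_Icc hεγ fun x hx => ?_
  have hx0 : x ≠ 0 := (hε.trans_le hx.1).ne'
  exact ((Real.continuousAt_rpow_const x (-β) (Or.inl hx0)).mul
    (continuousAt_inv₀ hx0)).continuousWithinAt

lemma abs_logSum_sub_le (hlam : ∀ n, 0 < lam n)
    (hfin : ∀ γ > 0, {n : ℕ | γ ≤ lam n}.Finite) {κ₁ κ₂ β₁ β₂ η γ : ℝ} (hβ₁ : 0 < β₁)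
    (hβ₂ : 0 < β₂) (hη : 0 ≤ η)
    (hM : ∀ x, 0 < x → x ≤ γ →
      |(indicesGE lam x).card - κ₁ * x ^ (-β₁) - κ₂ * x ^ (-β₂)| ≤ η * x ^ (-β₂))
    {ε : ℝ} (hε : 0 < ε) (hεγ : ε ≤ γ) :
    |logSum lam ε - κ₁ / β₁ * ε ^ (-β₁) - κ₂ / β₂ * ε ^ (-β₂)| ≤ η / β₂ * ε ^ (-β₂)
      + |logSum lam γ - κ₁ / β₁ * γ ^ (-β₁) - κ₂ / β₂ * γ ^ (-β₂)| := by
  have hγ : 0 < γ := hε.trans_le hεγ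
  have i0 := intervalIntegrable_card_div hfin hε hεγ
  have i1 := (intervalIntegrable_rpow_neg_mul_inv hε hεγ β₁).const_mul κ₁
  have i2 := (intervalIntegrable_rpow_neg_mul_inv hε hεγ β₂).const_mul κ₂
  have i3 := (intervalIntegrable_rpow_neg_mul_inv hε hεγ β₂).const_mul η
  have hbound : |∫ x in ε..γ, ((indicesGE lam x).card * x⁻¹ - κ₁ * (x ^ (-β₁) * x⁻¹)
      - κ₂ * (x ^ (-β₂) * x⁻¹))| ≤ ∫ x in ε..γ, η * (x ^ (-β₂) * x⁻¹) := by
    rw [← Real.norm_eq_abs]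
    refine intervalIntegral.norm_integral_le_of_norm_le hεγ (ae_of_all _ fun x hx => ?_) i3
    have hx0 : 0 < x := hε.trans hx.1
    calc _ = |(indicesGE lam x).card - κ₁ * x ^ (-β₁) - κ₂ * x ^ (-β₂)| * x⁻¹ := by
          rw [Real.norm_eq_abs, ← abs_of_pos (inv_pos.2 hx0), ← abs_mul,
            abs_of_pos (inv_pos.2 hx0)]
          ring_nf
      _ ≤ η * x ^ (-β₂) * x⁻¹ := by gcongr; exact hM x hx0 hx.2
      _ = _ := by ring
  rw [intervalIntegral.integral_sub (i0.sub i1) i2, intervalIntegral.integral_sub i0 i1,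
    intervalIntegral.integral_const_mul, intervalIntegral.integral_const_mul,
    intervalIntegral.integral_const_mul, integral_rpow_neg_mul_inv hε hεγ hβ₁,
    integral_rpow_neg_mul_inv hε hεγ hβ₂] at hbound
  rw [logSum_eq_integral hlam hfin hε hεγ]
  have hγ2 : 0 ≤ η / β₂ * γ ^ (-β₂) := by positivity
  have key : η * ((ε ^ (-β₂) - γ ^ (-β₂)) / β₂) ≤ η / β₂ * ε ^ (-β₂) := by
    have : η * ((ε ^ (-β₂) - γ ^ (-β₂)) / β₂)
      = η / β₂ * ε ^ (-β₂) - η / β₂ * γ ^ (-β₂) := by ring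
    linarith
  refine le_trans ?_ (add_le_add_left (hbound.trans key) _)
  refine le_trans (le_of_eq ?_) (abs_add_le _ _)
  congr 1
  ring

lemma logSum_sub_isLittleO (hlam : ∀ n, 0 < lam n)
    (hfin : ∀ γ > 0, {n : ℕ | γ ≤ lam n}.Finite) {κ₁ κ₂ β₁ β₂ : ℝ} (hβ₁ : 0 < β₁)
    (hβ₂ : 0 < β₂)
    (hM : (fun γ : ℝ => ((indicesGE lam γ).card : ℝ) - κ₁ * γ ^ (-β₁) - κ₂ * γ ^ (-β₂))
      =o[𝓝[>] 0] fun γ : ℝ => γ ^ (-β₂)) :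
    (fun ε : ℝ => logSum lam ε - κ₁ / β₁ * ε ^ (-β₁) - κ₂ / β₂ * ε ^ (-β₂))
      =o[𝓝[>] 0] fun ε : ℝ => ε ^ (-β₂) := by
  rw [isLittleO_iff] at hM ⊢
  intro c hc
  obtain ⟨u, hu0, hu⟩ := mem_nhdsGT_iff_exists_Ioc_subset.1 (hM (c := c * β₂ / 2) (by positivity))
  have hM' : ∀ x, 0 < x → x ≤ u →
      |(indicesGE lam x).card - κ₁ * x ^ (-β₁) - κ₂ * x ^ (-β₂)| ≤ c * β₂ / 2 * x ^ (-β₂) := by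
    intro x hx hxu
    have := hu (show x ∈ Set.Ioc 0 u from ⟨hx, hxu⟩)
    simpa [abs_of_pos (Real.rpow_pos_of_pos hx _)] using this
  set B := |logSum lam u - κ₁ / β₁ * u ^ (-β₁) - κ₂ / β₂ * u ^ (-β₂)|
  filter_upwards [Ioc_mem_nhdsGT hu0,
    (tendsto_rpow_neg_nhdsGT_zero (neg_lt_zero.2 hβ₂)).eventually_ge_atTop (2 * B / c)]
    with ε hε hεB
  have h := abs_logSum_sub_le hlam hfin hβ₁ hβ₂ (by positivity) hM' hε.1 hε.2
  rw [div_le_iff₀ hc] at hεB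
  rw [Real.norm_eq_abs, Real.norm_eq_abs, abs_of_pos (Real.rpow_pos_of_pos hε.1 _)]
  refine h.trans ?_
  have : c * β₂ / 2 / β₂ = c / 2 := by field_simp
  rw [this]
  linarith

/-- The leading-order asymptotics forces the counting function to be finite. -/
lemma finite_of_card_isLittleO {κ β : ℝ} (hκ : 0 < κ)
    (hM : (fun γ : ℝ => ((indicesGE lam γ).card : ℝ) - κ * γ ^ (-β))
      =o[𝓝[>] 0] fun γ : ℝ => γ ^ (-β)) {γ : ℝ} (hγ : 0 < γ) :
    {n : ℕ | γ ≤ lam n}.Finite := by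
  have h := (isLittleO_iff.1 hM (half_pos hκ)).and (Ioc_mem_nhdsGT hγ)
  obtain ⟨x, hx, hx0, hxγ⟩ := h.exists
  have hpos := Real.rpow_pos_of_pos hx0 (-β)
  rw [Real.norm_eq_abs, Real.norm_eq_abs, abs_of_pos hpos, abs_le] at hx
  have hfin : {n : ℕ | x ≤ lam n}.Finite := by
    by_contra hinf
    rw [indicesGE, dif_neg hinf, Finset.card_empty, Nat.cast_zero] at hx
    nlinarith [hx.1, mul_pos hκ hpos]
  exact hfin.subset fun n hn => hxγ.trans hn

end CountingFunction

section ErrorTerm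

lemma rpow_neg_isLittleO_rpow_neg {p q : ℝ} (h : p < q) :
    (fun ε : ℝ => ε ^ (-p)) =o[𝓝[>] 0] fun ε : ℝ => ε ^ (-q) := by
  have h0 : Tendsto (fun ε : ℝ => ε ^ (q - p)) (𝓝[>] 0) (𝓝 0) := by
    have := (Real.continuousAt_rpow_const 0 (q - p) (Or.inr (by linarith))).tendsto
    rw [Real.zero_rpow (by linarith)] at this
    exact this.mono_left nhdsWithin_le_nhds
  have h1 := ((isLittleO_one_iff ℝ).2 h0).mul_isBigO
    (isBigO_refl (fun ε : ℝ => ε ^ (-q)) (𝓝[>] 0))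
  refine h1.congr' ?_ (by simp)
  filter_upwards [self_mem_nhdsWithin] with ε hε
  rw [← Real.rpow_add hε]
  congr 1
  ring

lemma rpow_neg_isBigO_rpow_neg {p q : ℝ} (h : p ≤ q) :
    (fun ε : ℝ => ε ^ (-p)) =O[𝓝[>] 0] fun ε : ℝ => ε ^ (-q) := by
  rcases h.eq_or_lt with rfl | h
  · exact isBigO_refl _ _
  · exact (rpow_neg_isLittleO_rpow_neg h).isBigO

lemma const_isBigO_rpow_neg (c : ℝ) {s : ℝ} (hs : 0 ≤ s) :
    (fun _ : ℝ => c) =O[𝓝[>] 0] fun ε : ℝ => ε ^ (-s) := by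
  have h := (isBigO_const_const c (one_ne_zero : (1 : ℝ) ≠ 0) (𝓝[>] (0 : ℝ))).trans
    (by simpa using rpow_neg_isBigO_rpow_neg hs : (fun _ : ℝ => (1 : ℝ)) =O[𝓝[>] 0] _)
  exact h

lemma log_isBigO_rpow_neg {f : ℝ → ℝ} {p s : ℝ} (hp : 0 ≤ p) (hs : 0 < s)
    (hf1 : ∀ᶠ ε in 𝓝[>] 0, 1 ≤ f ε) (hf : f =O[𝓝[>] 0] fun ε : ℝ => ε ^ (-p)) :
    (fun ε => Real.log (f ε)) =O[𝓝[>] 0] fun ε : ℝ => ε ^ (-s) := by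
  obtain ⟨C, hC0, hC⟩ := hf.exists_pos
  have h1 : (fun ε => Real.log (f ε)) =O[𝓝[>] 0] fun ε : ℝ => |Real.log C| + p / s * ε ^ (-s) := by
    refine IsBigO.of_bound 1 ?_
    filter_upwards [hf1, hC.bound, self_mem_nhdsWithin] with ε h1 h2 (hε : 0 < ε)
    have hpos := Real.rpow_pos_of_pos hε (-p)
    rw [Real.norm_eq_abs, Real.norm_eq_abs, abs_of_pos hpos, abs_of_pos (by linarith)] at h2
    have h3 := Real.log_le_log (by linarith) h2
    rw [Real.log_mul hC0.ne' hpos.ne', Real.log_rpow hε] at h3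
    have h4 := Real.log_le_rpow_div (inv_pos.2 hε).le hs
    rw [Real.log_inv, Real.inv_rpow hε.le, ← Real.rpow_neg hε.le] at h4
    have hs' := Real.rpow_pos_of_pos hε (-s)
    rw [Real.norm_eq_abs, Real.norm_eq_abs, abs_of_nonneg (Real.log_nonneg h1),
      abs_of_nonneg (by positivity), one_mul]
    have h5 := mul_le_mul_of_nonneg_left h4 hp
    have h6 : p * (ε ^ (-s) / s) = p / s * ε ^ (-s) := by ring
    linarith [le_abs_self (Real.log C)]
  exact h1.trans ((const_isBigO_rpow_neg _ hs.le).add ((isBigO_refl _ _).const_mul_left _))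

lemma natCeil_mul_rpow_neg_isBigO {c p : ℝ} (hc : 0 ≤ c) (hp : 0 ≤ p) :
    (fun ε : ℝ => (⌈c * ε ^ (-p)⌉₊ : ℝ)) =O[𝓝[>] 0] fun ε : ℝ => ε ^ (-p) := by
  have h1 : (fun ε : ℝ => (⌈c * ε ^ (-p)⌉₊ : ℝ)) =O[𝓝[>] 0] fun ε : ℝ => c * ε ^ (-p) + 1 := by
    refine IsBigO.of_bound 1 ?_
    filter_upwards [self_mem_nhdsWithin] with ε (hε : 0 < ε)
    have : 0 ≤ c * ε ^ (-p) := mul_nonneg hc (Real.rpow_pos_of_pos hε _).le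
    rw [Real.norm_eq_abs, Real.norm_eq_abs, abs_of_nonneg (Nat.cast_nonneg _),
      abs_of_nonneg (by linarith), one_mul]
    exact (Nat.ceil_lt_add_one this).le
  exact h1.trans (((isBigO_refl _ _).const_mul_left _).add (const_isBigO_rpow_neg _ hp))

variable {lam : ℕ → ℝ}

lemma card_indicesGE_div_isBigO (hfin : ∀ γ > 0, {n : ℕ | γ ≤ lam n}.Finite) {β : ℝ}
    (hM : (fun γ : ℝ => ((indicesGE lam γ).card : ℝ)) =O[𝓝[>] 0] fun γ : ℝ => γ ^ (-β))
    {a : ℝ → ℝ} (ha : ∀ᶠ ε in 𝓝[>] 0, 0 < a ε ∧ a ε ≤ 1) :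
    (fun ε : ℝ => ((indicesGE lam (ε / (1 + a ε))).card : ℝ))
      =O[𝓝[>] 0] fun ε : ℝ => ε ^ (-β) := by
  have ht : Tendsto (fun ε : ℝ => ε / 2) (𝓝[>] 0) (𝓝[>] 0) := by
    refine tendsto_nhdsWithin_iff.2 ⟨?_, ?_⟩
    · have : Tendsto (fun ε : ℝ => ε / 2) (𝓝 0) (𝓝 (0 / 2)) := by
        exact (continuous_id.div_const 2).tendsto 0
      rw [zero_div] at this
      exact this.mono_left nhdsWithin_le_nhds
    · filter_upwards [self_mem_nhdsWithin] with ε (hε : 0 < ε)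
      exact half_pos hε
  have h1 := hM.comp_tendsto ht
  have h2 : (fun ε : ℝ => (ε / 2) ^ (-β)) =O[𝓝[>] 0] fun ε : ℝ => ε ^ (-β) := by
    refine ((isBigO_refl (fun ε : ℝ => ε ^ (-β)) (𝓝[>] 0)).const_mul_left
      ((2 : ℝ) ^ (-β))⁻¹).congr' ?_ EventuallyEq.rfl
    filter_upwards [self_mem_nhdsWithin] with ε (hε : 0 < ε)
    rw [Real.div_rpow hε.le zero_le_two]
    ring
  refine IsBigO.trans (IsBigO.of_bound 1 ?_) (h1.trans h2)
  filter_upwards [ha, self_mem_nhdsWithin] with ε ⟨ha0, ha1⟩ (hε : 0 < ε)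
  rw [Function.comp_apply, one_mul, Real.norm_natCast, Real.norm_natCast]
  refine Nat.cast_le.2 (Finset.card_le_card fun n hn => ?_)
  rw [mem_indicesGE (hfin _ (by positivity))] at hn ⊢
  refine le_trans ?_ hn
  gcongr
  linarith

/-- The covering number is `exp (logSum lam ε)` up to a multiplicative error whose logarithm is of
smaller order than `ε ^ (-β₂)`. -/
lemma log_coveringNumber_sub_logSum_isLittleO
    {H : Type*} [NormedAddCommGroup H] [InnerProductSpace ℝ H] [CompleteSpace H]
    {T : H →L[ℝ] H} (hT : T.IsPositive) {ψ : ℕ → H} (hON : Orthonormal ℝ ψ)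
    (hdense : (Submodule.span ℝ (Set.range ψ)).topologicalClosure = ⊤)
    (heig : ∀ n, T (ψ n) = lam n • ψ n) (hlam : ∀ n, 0 < lam n)
    (hfin : ∀ γ > 0, {n : ℕ | γ ≤ lam n}.Finite) {β β₂ : ℝ} (hβ : 0 < β) (hβ₂ : β / 2 < β₂)
    (hM : (fun γ : ℝ => ((indicesGE lam γ).card : ℝ)) =O[𝓝[>] 0] fun γ : ℝ => γ ^ (-β)) :
    (fun ε : ℝ => Real.log (coveringNumber ε (closure (T '' Metric.closedBall 0 1)))
      - logSum lam ε) =o[𝓝[>] 0] fun ε : ℝ => ε ^ (-β₂) := by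
  obtain ⟨s, hs0, hs⟩ : ∃ s : ℝ, 0 < s ∧ β / 2 + s + s < β₂ :=
    ⟨(β₂ - β / 2) / 3, by linarith, by linarith⟩
  set a : ℝ → ℝ := fun ε => ε ^ (β / 2)
  set J : ℝ → ℕ := fun ε => ⌈1 * ε ^ (-(β / 2 + s))⌉₊
  set K : ℝ → ℕ := fun ε => ⌈2 * ε ^ (-(β + s))⌉₊
  set m : ℝ → ℕ := fun ε => (indicesGE lam (ε / (1 + a ε))).card
  have hunit : Set.Ioc (0 : ℝ) 1 ∈ 𝓝[>] (0 : ℝ) := Ioc_mem_nhdsGT one_pos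
  have ha : ∀ᶠ ε in 𝓝[>] 0, 0 < a ε ∧ a ε ≤ 1 := by
    filter_upwards [hunit] with ε hε
    exact ⟨Real.rpow_pos_of_pos hε.1 _, Real.rpow_le_one hε.1.le hε.2 (by positivity)⟩
  have hmO : (fun ε => (m ε : ℝ)) =O[𝓝[>] 0] fun ε : ℝ => ε ^ (-β) :=
    card_indicesGE_div_isBigO hfin hM ha
  have hJO : (fun ε => (J ε : ℝ)) =O[𝓝[>] 0] fun ε : ℝ => ε ^ (-(β / 2 + s)) :=
    natCeil_mul_rpow_neg_isBigO zero_le_one (by positivity)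
  have hKO : (fun ε => (K ε : ℝ) + 1) =O[𝓝[>] 0] fun ε : ℝ => ε ^ (-(β + s)) :=
    (natCeil_mul_rpow_neg_isBigO zero_le_two (by positivity)).add
      (const_isBigO_rpow_neg _ (by positivity))
  have haO : (fun ε => Real.log (1 + a ε)) =O[𝓝[>] 0] fun ε : ℝ => ε ^ (-(-(β / 2))) := by
    refine IsBigO.of_bound 1 ?_
    filter_upwards [ha] with ε ⟨h0, h1⟩
    rw [Real.norm_eq_abs, Real.norm_eq_abs, neg_neg, one_mul, abs_of_pos h0,
      abs_of_nonneg (Real.log_nonneg (by linarith))]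
    have := Real.log_le_sub_one_of_pos (show 0 < 1 + a ε by linarith)
    linarith
  have hmul : ∀ {f g : ℝ → ℝ} {p q r : ℝ}, f =O[𝓝[>] 0] (fun ε : ℝ => ε ^ (-p)) →
      g =O[𝓝[>] 0] (fun ε : ℝ => ε ^ (-q)) → p + q = r →
      (fun ε => f ε * g ε) =O[𝓝[>] 0] fun ε : ℝ => ε ^ (-r) := by
    intro f g p q r hf hg h
    refine (hf.mul hg).congr' EventuallyEq.rfl ?_
    filter_upwards [self_mem_nhdsWithin] with ε (hε : 0 < ε)
    rw [← Real.rpow_add hε, ← h]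
    congr 1
    ring
  have hE : (fun ε => 2 * a ε * m ε + J ε * (Real.log (K ε + 1) + Real.log 300
      + 4 * Real.log (m ε + 1) + J ε * Real.log (1 + a ε)))
      =O[𝓝[>] 0] fun ε : ℝ => ε ^ (-(β / 2 + s + s)) := by
    have h1 : (fun ε => 2 * a ε * m ε) =O[𝓝[>] 0] fun ε : ℝ => ε ^ (-(β / 2)) :=
      hmul (p := -(β / 2)) (q := β)
        (by simpa [a] using (isBigO_refl a (𝓝[>] 0)).const_mul_left 2) hmO (by ring)
    have h2 := log_isBigO_rpow_neg (by positivity) hs0 (Eventually.of_forall fun ε =>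
      le_add_of_nonneg_left (Nat.cast_nonneg (K ε))) hKO
    have h3 := log_isBigO_rpow_neg hβ.le hs0 (Eventually.of_forall fun ε =>
      le_add_of_nonneg_left (Nat.cast_nonneg (m ε)))
      (hmO.add (const_isBigO_rpow_neg 1 hβ.le))
    have h4 := hmul hJO haO (show β / 2 + s + -(β / 2) = s by ring)
    have h5 := hmul hJO (((h2.add (const_isBigO_rpow_neg (Real.log 300) hs0.le)).add
      (h3.const_mul_left 4)).add h4) rfl
    exact (h1.trans (rpow_neg_isBigO_rpow_neg (by linarith))).add h5
  have hlog : ∀ᶠ ε : ℝ in 𝓝[>] 0, Real.log (2 * max ‖T‖ 1 * ε ^ (-1 : ℝ)) ≤ ε ^ (-s) / 2 := by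
    have h1 : (fun ε : ℝ => 2 * max ‖T‖ 1 * ε ^ (-1 : ℝ)) =O[𝓝[>] 0] fun ε : ℝ => ε ^ (-1 : ℝ) :=
      (isBigO_refl _ _).const_mul_left _
    have h2 := (log_isBigO_rpow_neg zero_le_one (half_pos hs0) ?_ h1).trans_isLittleO
      (rpow_neg_isLittleO_rpow_neg (half_lt_self hs0))
    · filter_upwards [isLittleO_iff.1 h2 (half_pos one_pos), self_mem_nhdsWithin]
        with ε h (hε : 0 < ε)
      rw [Real.norm_eq_abs, Real.norm_eq_abs, abs_of_pos (Real.rpow_pos_of_pos hε _)] at h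
      linarith [le_abs_self (Real.log (2 * max ‖T‖ 1 * ε ^ (-1 : ℝ)))]
    · filter_upwards [hunit] with ε hε
      have h3 := Real.one_le_rpow_of_pos_of_le_one_of_nonpos hε.1 hε.2
        (show (-1 : ℝ) ≤ 0 by norm_num)
      nlinarith [le_max_right ‖T‖ 1]
  refine IsBigO.trans_isLittleO (IsBigO.of_bound 1 ?_)
    (hE.trans_isLittleO (rpow_neg_isLittleO_rpow_neg hs))
  filter_upwards [ha, hlog, hunit] with ε ⟨ha0, ha1⟩ hl hε
  have hJlow : ε ^ (-(β / 2 + s)) ≤ J ε := by simpa [J] using Nat.le_ceil (ε ^ (-(β / 2 + s)))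
  have hJ : ∀ n, lam n ≤ ε / (1 + a ε) * (1 + a ε) ^ J ε := by
    intro n
    have hn : lam n ≤ max ‖T‖ 1 := by
      refine le_trans ?_ (le_max_left _ _)
      have := T.le_opNorm (ψ n)
      rwa [heig, norm_smul, hON.1 n, mul_one, mul_one, Real.norm_eq_abs,
        abs_of_pos (hlam n)] at this
    have h1 : a ε / 2 ≤ Real.log (1 + a ε) := by
      refine le_trans ?_ (Real.le_log_one_add_of_nonneg ha0.le)
      rw [div_le_div_iff₀ two_pos (by linarith)]
      nlinarith
    have h2 : ε ^ (-(β / 2 + s)) * a ε = ε ^ (-s) := by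
      rw [← Real.rpow_add hε.1]
      congr 1
      ring
    have h3 : ε ^ (-s) / 2 ≤ J ε * Real.log (1 + a ε) := by
      calc ε ^ (-s) / 2 = ε ^ (-(β / 2 + s)) * (a ε / 2) := by rw [← h2]; ring
        _ ≤ _ := by gcongr
    have hpos : 0 < 2 * max ‖T‖ 1 * ε ^ (-1 : ℝ) := by
      have := Real.rpow_pos_of_pos hε.1 (-1)
      have : 0 < max ‖T‖ 1 := lt_max_of_lt_right one_pos
      positivity
    have h4 := (Real.log_le_log_iff hpos (by positivity : 0 < (1 + a ε) ^ J ε)).1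
      ((hl.trans h3).trans_eq (Real.log_pow _ _).symm)
    rw [Real.rpow_neg_one, ← div_eq_mul_inv, div_le_iff₀ hε.1] at h4
    rw [div_mul_eq_mul_div, le_div_iff₀ (by linarith)]
    nlinarith [hlam n]
  have hKlow : 2 * ε ^ (-(β + s)) ≤ K ε := Nat.le_ceil _
  have hone : ∀ p : ℝ, 0 ≤ p → 1 ≤ ε ^ (-p) := fun p hp =>
    Real.one_le_rpow_of_pos_of_le_one_of_nonpos hε.1 hε.2 (by linarith)
  have hK : 1 ≤ K ε := by
    have : (1 : ℝ) ≤ K ε := by linarith [hone (β + s) (by positivity)]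
    exact_mod_cast this
  have hJK : (J ε : ℝ) ≤ a ε * K ε := by
    have h1 : (J ε : ℝ) ≤ ε ^ (-(β / 2 + s)) + 1 := by
      have := (Nat.ceil_lt_add_one (Real.rpow_pos_of_pos hε.1 (-(β / 2 + s))).le).le
      simpa [J] using this
    have h2 : a ε * (2 * ε ^ (-(β + s))) = 2 * ε ^ (-(β / 2 + s)) := by
      rw [mul_left_comm, ← Real.rpow_add hε.1]
      congr 2
      ring
    have h3 := mul_le_mul_of_nonneg_left hKlow ha0.le
    linarith [hone (β / 2 + s) (by positivity)]
  obtain ⟨hlow, hupp⟩ :=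
    logSum_le_log_coveringNumber_le hT hON hdense heig hlam hfin hε.1 ha0 hJ hK hJK
  rw [Real.norm_eq_abs, abs_of_nonneg (sub_nonneg.2 hlow), one_mul]
  refine le_trans ?_ (le_abs_self _)
  linarith

end ErrorTerm

theorem entropy_of_compact_operator_counting_function
    {H : Type*} [NormedAddCommGroup H] [InnerProductSpace ℝ H] [CompleteSpace H]
    [SeparableSpace H]
    (T : H →L[ℝ] H) (hcomp : IsCompactOperator T) (hposop : T.IsPositive)
    -- `ψ` is an orthonormal basis of `H` consisting of eigenvectors of `T`,
    -- with eigenvalues `lam n`, counted with multiplicity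
    (ψ : ℕ → H) (hON : Orthonormal ℝ ψ)
    (hdense : (Submodule.span ℝ (Set.range ψ)).topologicalClosure = ⊤)
    (lam : ℕ → ℝ) (heig : ∀ n, T (ψ n) = lam n • ψ n)
    (hlampos : ∀ n, 0 < lam n)
    (κ₁ κ₂ β₁ β₂ : ℝ) (hκ₁ : 0 < κ₁) (hβ₁ : 0 < β₁) (hβ₂ : 0 < β₂)
    (hcase : (β₁ / 2 < β₂ ∧ β₂ < β₁) ∨ (β₁ = β₂ ∧ κ₂ = 0))
    -- the eigenvalue-counting function `M_T(γ) = #{n : λ_n ≥ γ}` satisfies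
    -- `M_T(γ) = κ₁ γ^{-β₁} + κ₂ γ^{-β₂} + o(γ^{-β₂})` as `γ → 0`
    (hasymp : (fun γ : ℝ => (Nat.card {n : ℕ | γ ≤ lam n} : ℝ)
        - κ₁ * γ ^ (-β₁) - κ₂ * γ ^ (-β₂))
      =o[𝓝[>] 0] fun γ : ℝ => γ ^ (-β₂)) :
    (fun ε : ℝ => opEntropy ε T
        - κ₁ / (β₁ * Real.log 2) * ε ^ (-β₁)
        - κ₂ / (β₂ * Real.log 2) * ε ^ (-β₂))
      =o[𝓝[>] 0] fun ε : ℝ => ε ^ (-β₂) := by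
  simp only [card_indicesGE] at hasymp
  have hβ : β₁ / 2 < β₂ := by
    rcases hcase with h | ⟨h, -⟩
    · exact h.1
    · linarith
  have hM : (fun γ : ℝ => ((indicesGE lam γ).card : ℝ) - κ₁ * γ ^ (-β₁))
      =o[𝓝[>] 0] fun γ : ℝ => γ ^ (-β₁) := by
    rcases hcase with ⟨-, h⟩ | ⟨rfl, rfl⟩
    · have h1 := rpow_neg_isLittleO_rpow_neg h
      refine ((hasymp.trans h1).add (h1.const_mul_left κ₂)).congr_left fun γ => ?_
      ring
    · simpa using hasymp
  have hfin : ∀ γ > 0, {n : ℕ | γ ≤ lam n}.Finite := fun γ hγ =>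
    finite_of_card_isLittleO hκ₁ hM hγ
  have hMO : (fun γ : ℝ => ((indicesGE lam γ).card : ℝ)) =O[𝓝[>] 0] fun γ : ℝ => γ ^ (-β₁) :=
    (hM.isBigO.add ((isBigO_refl _ _).const_mul_left κ₁)).congr_left fun γ => by ring
  have h1 := log_coveringNumber_sub_logSum_isLittleO hposop hON hdense heig hlampos hfin hβ₁ hβ hMO
  have h2 := logSum_sub_isLittleO hlampos hfin hβ₁ hβ₂ hasymp
  refine ((h1.add h2).const_mul_left (Real.log 2)⁻¹).congr_left fun ε => ?_
  have hlog2 : Real.log 2 ≠ 0 := (Real.log_pos one_lt_two).ne'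
  rw [opEntropy, metricEntropy, Real.logb]
  field_simp
  ring
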